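/- arXiv:1708.02819 — 4 statements merged into one kernel-verified Lean document; each statement's English description precedes it below -/
import Mathlib

section
/- Let α, β ∈ ℂ with α ≠ 0 and let P be a polynomial that does not vanish identically, and set f(z) = P(z) sin(αz + β). Then logarea(Δ \ (I(f) ∩ J(f))) < ∞; in particular, area J(f) > 0. -/
open MeasureTheory Filter Metric Set Topology ENNReal

/-- Logarithmic area of a subset of the plane. -/
noncomputable def logArea (A : Set ℂ) : ℝ≥0∞ :=
  ∫⁻ z in A, ENNReal.ofReal ((‖z‖ ^ 2)⁻¹)

/-- The set Δ = {z : |z| ≥ 1}. -/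
def Delta : Set ℂ := {z : ℂ | 1 ≤ ‖z‖}

/-- Chordal (spherical) distance on the Riemann sphere ℂ ∪ {∞}, with ∞ encoded as `none`. -/
noncomputable def chordalDist : Option ℂ → Option ℂ → ℝ
  | none, none => 0
  | none, some w => 2 / Real.sqrt (1 + ‖w‖ ^ 2)
  | some z, none => 2 / Real.sqrt (1 + ‖z‖ ^ 2)
  | some z, some w =>
      2 * ‖z - w‖ / (Real.sqrt (1 + ‖z‖ ^ 2) * Real.sqrt (1 + ‖w‖ ^ 2))

/-- Locally uniform convergence on `U` of a sequence of ℂ-valued functions towards a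
function with values in the Riemann sphere, with respect to the spherical metric. -/
def SphLocUnifConvOn (F : ℕ → ℂ → ℂ) (g : ℂ → Option ℂ) (U : Set ℂ) : Prop :=
  ∀ K : Set ℂ, K ⊆ U → IsCompact K → ∀ ε : ℝ, 0 < ε →
    ∀ᶠ n in atTop, ∀ z ∈ K, chordalDist (some (F n z)) (g z) < ε

/-- The Fatou set: points having a neighborhood on which every sequence of iterates has a
subsequence converging locally uniformly with respect to the spherical metric. -/
def fatouSet (f : ℂ → ℂ) : Set ℂ :=
  {z | ∃ U ∈ 𝓝 z, ∀ φ : ℕ → ℕ, StrictMono φ →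
    ∃ ψ : ℕ → ℕ, StrictMono ψ ∧ ∃ g : ℂ → Option ℂ,
      SphLocUnifConvOn (fun n => f^[φ (ψ n)]) g U}

/-- The Julia set. -/
def juliaSet (f : ℂ → ℂ) : Set ℂ := (fatouSet f)ᶜ

/-- The escaping set. -/
def escapingSet (f : ℂ → ℂ) : Set ℂ :=
  {z | Tendsto (fun n => ‖f^[n] z‖) atTop atTop}

/-- The Fatou set has no multiply connected component. -/
def NoMultiplyConnectedFatouComponent (f : ℂ → ℂ) : Prop :=
  ∀ z ∈ fatouSet f, SimplyConnectedSpace (connectedComponentIn (fatouSet f) z)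

/-- Maximum modulus M(r,f). -/
noncomputable def maxMod (f : ℂ → ℂ) (r : ℝ) : ℝ :=
  sSup ((fun z => ‖f z‖) '' {z : ℂ | ‖z‖ = r})

/-- The order ρ(f) of an entire function, as an extended real number. -/
noncomputable def entireOrder (f : ℂ → ℂ) : EReal :=
  limsup (fun r : ℝ => ((Real.log (Real.log (maxMod f r)) / Real.log r : ℝ) : EReal)) atTop

/-- The fast escaping set A(f). -/
def fastEscapingSet (f : ℂ → ℂ) : Set ℂ :=
  {z | ∃ R : ℝ, 0 < R ∧ (∀ r : ℝ, R ≤ r → r < maxMod f r) ∧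
    ∃ L : ℕ, ∀ n : ℕ, L < n → (maxMod f)^[n - L] R ≤ ‖f^[n] z‖}

/-- `f` is a transcendental entire function. -/
def TranscendentalEntire (f : ℂ → ℂ) : Prop :=
  Differentiable ℂ f ∧ ¬ ∃ p : Polynomial ℂ, ∀ z, f z = p.eval z

/-- Order of vanishing of `g` at `z` (the least `k` with nonzero `k`-th derivative). -/
noncomputable def vanishingOrder (g : ℂ → ℂ) (z : ℂ) : ℕ :=
  sInf {k : ℕ | iteratedDeriv k g z ≠ 0}

/-- n(r,a): the number of solutions of f(z) = a with |z| ≤ r, counted with multiplicity. -/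
noncomputable def nCount (f : ℂ → ℂ) (a : ℂ) (r : ℝ) : ℕ :=
  ∑ᶠ z ∈ {z : ℂ | ‖z‖ ≤ r ∧ f z = a}, vanishingOrder (fun w => f w - a) z

/-- n(r) = max over a of n(r,a). -/
noncomputable def nMax (f : ℂ → ℂ) (r : ℝ) : ℕ := ⨆ a : ℂ, nCount f a r

/-- Critical values of `f`. -/
def criticalValues (f : ℂ → ℂ) : Set ℂ := {w | ∃ z, deriv f z = 0 ∧ f z = w}

/-- Finite asymptotic values of `f`. -/
def asymptoticValues (f : ℂ → ℂ) : Set ℂ :=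
  {w | ∃ γ : ℝ → ℂ, Continuous γ ∧ Tendsto (fun t => ‖γ t‖) atTop atTop ∧
    Tendsto (fun t => f (γ t)) atTop (𝓝 w)}

/-- The Eremenko–Lyubich class B. -/
def ELClass (f : ℂ → ℂ) : Prop :=
  TranscendentalEntire f ∧ Bornology.IsBounded (criticalValues f ∪ asymptoticValues f)

/-- Semihyperbolic polynomial. -/
def SemiHyperbolic (p : Polynomial ℂ) : Prop :=
  ∃ ε : ℝ, 0 < ε ∧ ∃ N : ℕ, ∀ z ∈ juliaSet (fun w => p.eval w), ∀ n : ℕ, 1 ≤ n →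
    ∀ V : Set ℂ, (∃ u ∈ (fun w => p.eval w)^[n] ⁻¹' ball z ε,
        V = connectedComponentIn ((fun w => p.eval w)^[n] ⁻¹' ball z ε) u) →
      ∀ w ∈ ball z ε,
        (∑ᶠ u ∈ {u : ℂ | u ∈ V ∧ (fun v => p.eval v)^[n] u = w},
          vanishingOrder (fun ζ => (fun v => p.eval v)^[n] ζ - w) u) ≤ N

/-! ### Growth of the sine and cosine away from the real axis -/

section SineGrowth

lemma norm_exp_mul_I (ζ : ℂ) : ‖Complex.exp (ζ * Complex.I)‖ = Real.exp (-ζ.im) := by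
  rw [Complex.norm_exp]; simp

lemma norm_exp_neg_mul_I (ζ : ℂ) : ‖Complex.exp (-ζ * Complex.I)‖ = Real.exp ζ.im := by
  rw [Complex.norm_exp]; simp

lemma exp_abs_bounds (y : ℝ) (hy : 1 ≤ |y|) :
    Real.exp |y| / 2 ≤ |Real.exp y - Real.exp (-y)| := by
  have key : ∀ t : ℝ, 1 ≤ t → Real.exp t / 2 ≤ Real.exp t - Real.exp (-t) := by
    intro t ht
    have h1 : t + 1 ≤ Real.exp t := Real.add_one_le_exp t
    have h2 : Real.exp t * Real.exp (-t) = 1 := by rw [← Real.exp_add]; simp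
    have h3 := Real.exp_pos (-t)
    nlinarith
  rcases abs_cases y with ⟨h, _⟩ | ⟨h, _⟩
  · rw [h] at hy ⊢
    exact (key y hy).trans (le_abs_self _)
  · rw [h] at hy ⊢
    have := key (-y) hy
    rw [neg_neg] at this
    rw [abs_sub_comm]
    exact this.trans (le_abs_self _)

lemma exp_add_exp_neg_le (y : ℝ) : Real.exp y + Real.exp (-y) ≤ 2 * Real.exp |y| := by
  have h1 := Real.exp_le_exp.2 (le_abs_self y)
  have h2 := Real.exp_le_exp.2 (neg_le_abs y)
  linarith

lemma norm_sin_le (ζ : ℂ) : ‖Complex.sin ζ‖ ≤ Real.exp |ζ.im| := by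
  have := norm_sub_le (Complex.exp (-ζ * Complex.I)) (Complex.exp (ζ * Complex.I))
  rw [norm_exp_neg_mul_I, norm_exp_mul_I] at this
  rw [Complex.sin, norm_div, norm_mul, Complex.norm_I]
  have := exp_add_exp_neg_le ζ.im
  simp only [Complex.norm_ofNat]
  linarith

lemma norm_cos_le (ζ : ℂ) : ‖Complex.cos ζ‖ ≤ Real.exp |ζ.im| := by
  have := norm_add_le (Complex.exp (ζ * Complex.I)) (Complex.exp (-ζ * Complex.I))
  rw [norm_exp_neg_mul_I, norm_exp_mul_I] at this
  rw [Complex.cos, norm_div]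
  have := exp_add_exp_neg_le ζ.im
  simp only [Complex.norm_ofNat]
  linarith

lemma le_norm_sin (ζ : ℂ) (h : 1 ≤ |ζ.im|) : Real.exp |ζ.im| / 4 ≤ ‖Complex.sin ζ‖ := by
  have := abs_norm_sub_norm_le (Complex.exp (-ζ * Complex.I)) (Complex.exp (ζ * Complex.I))
  rw [norm_exp_neg_mul_I, norm_exp_mul_I] at this
  rw [Complex.sin, norm_div, norm_mul, Complex.norm_I]
  have := exp_abs_bounds ζ.im h
  simp only [Complex.norm_ofNat]
  linarith

lemma le_norm_cos (ζ : ℂ) (h : 1 ≤ |ζ.im|) : Real.exp |ζ.im| / 4 ≤ ‖Complex.cos ζ‖ := by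
  have := abs_norm_sub_norm_le (Complex.exp (-ζ * Complex.I)) (-Complex.exp (ζ * Complex.I))
  rw [norm_neg, norm_exp_neg_mul_I, norm_exp_mul_I, sub_neg_eq_add, add_comm (Complex.exp _)] at this
  rw [Complex.cos, norm_div]
  have := exp_abs_bounds ζ.im h
  simp only [Complex.norm_ofNat]
  linarith

end SineGrowth

/-! ### Polynomials near infinity -/

section PolynomialGrowth

open Polynomial

lemma eval_eq_pow_mul_eval_reverse (P : ℂ[X]) {z : ℂ} (hz : z ≠ 0) :
    P.eval z = z ^ P.natDegree * P.reverse.eval z⁻¹ := by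
  have := invertibleOfNonzero hz
  have h := Polynomial.eval₂_reverse_mul_pow (RingHom.id ℂ) z P
  rw [invOf_eq_inv] at h
  rw [Polynomial.eval, Polynomial.eval, ← h, mul_comm]

lemma exists_norm_eval_le (P : ℂ[X]) :
    ∃ C : ℝ, 0 < C ∧ ∀ z : ℂ, 1 ≤ ‖z‖ → ‖P.eval z‖ ≤ C * ‖z‖ ^ P.natDegree := by
  obtain ⟨C, hC⟩ := (isCompact_closedBall (0 : ℂ) 1).exists_bound_of_continuousOn
    (f := fun z => P.reverse.eval z) P.reverse.continuous.continuousOn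
  refine ⟨max C 1, by positivity, fun z hz => ?_⟩
  have hz0 : z ≠ 0 := norm_pos_iff.1 (by linarith)
  rw [eval_eq_pow_mul_eval_reverse P hz0, norm_mul, norm_pow, mul_comm]
  have : ‖P.reverse.eval z⁻¹‖ ≤ C := hC _ (by simpa using inv_le_one_of_one_le₀ hz)
  gcongr
  exact this.trans (le_max_left _ _)

lemma exists_le_norm_eval {P : ℂ[X]} (hP : P ≠ 0) :
    ∃ c : ℝ, 0 < c ∧ ∃ R : ℝ, ∀ z : ℂ, R ≤ ‖z‖ → c * ‖z‖ ^ P.natDegree ≤ ‖P.eval z‖ := by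
  have hl : 0 < ‖P.leadingCoeff‖ := norm_pos_iff.2 (leadingCoeff_ne_zero.2 hP)
  have hcont : ContinuousAt (fun z => ‖P.reverse.eval z‖) 0 := P.reverse.continuous.norm.continuousAt
  have h0 : ‖P.leadingCoeff‖ / 2 < ‖P.reverse.eval 0‖ := by
    rw [← coeff_zero_eq_eval_zero, coeff_zero_reverse]; linarith
  obtain ⟨r, hr, hball⟩ := Metric.eventually_nhds_iff.1 (hcont.eventually_const_lt h0)
  refine ⟨‖P.leadingCoeff‖ / 2, by positivity, 2 / r, fun z hz => ?_⟩
  have hzpos : 0 < ‖z‖ := lt_of_lt_of_le (by positivity) hz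
  have hz0 : z ≠ 0 := norm_pos_iff.1 hzpos
  rw [eval_eq_pow_mul_eval_reverse P hz0, norm_mul, norm_pow, mul_comm]
  gcongr
  refine (hball ?_).le
  rw [dist_zero_right, norm_inv, inv_lt_comm₀ hzpos hr]
  refine lt_of_lt_of_le ?_ hz
  rw [inv_eq_one_div]; gcongr; norm_num

lemma exists_norm_eval_add_le {P Q : ℂ[X]} (hP : P ≠ 0) (hQ : Q.natDegree ≤ P.natDegree) :
    ∃ K : ℝ, 0 < K ∧ ∃ R : ℝ, ∀ z : ℂ, R ≤ ‖z‖ → ∀ w ∈ ball z 1,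
      ‖Q.eval w‖ ≤ K * ‖P.eval z‖ := by
  obtain ⟨C, hC, hCQ⟩ := exists_norm_eval_le Q
  obtain ⟨c, hc, R, hR⟩ := exists_le_norm_eval hP
  refine ⟨C * 2 ^ P.natDegree / c, by positivity, max R 2, fun z hz w hw => ?_⟩
  have hz2 : 2 ≤ ‖z‖ := (le_max_right _ _).trans hz
  have hd : ‖w - z‖ < 1 := by rwa [mem_ball, dist_eq_norm] at hw
  have hw1 : 1 ≤ ‖w‖ := by
    have := norm_sub_norm_le z w
    rw [norm_sub_rev] at this
    linarith
  have hw2 : ‖w‖ ≤ 2 * ‖z‖ := by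
    have := norm_sub_norm_le w z
    linarith
  calc ‖Q.eval w‖ ≤ C * ‖w‖ ^ Q.natDegree := hCQ w hw1
    _ ≤ C * ‖w‖ ^ P.natDegree := by gcongr
    _ ≤ C * (2 * ‖z‖) ^ P.natDegree := by gcongr
    _ = C * 2 ^ P.natDegree / c * (c * ‖z‖ ^ P.natDegree) := by
        rw [mul_pow]; field_simp
    _ ≤ _ := by gcongr; exact hR z ((le_max_left _ _).trans hz)

lemma exists_norm_eval_derivative_le {P : ℂ[X]} (hP : P ≠ 0) {η : ℝ} (hη : 0 < η) :
    ∃ R : ℝ, ∀ z : ℂ, R ≤ ‖z‖ → ‖P.derivative.eval z‖ ≤ η * ‖P.eval z‖ := by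
  rcases Nat.eq_zero_or_pos P.natDegree with hd | hd
  · refine ⟨0, fun z _ => ?_⟩
    rw [derivative_of_natDegree_zero hd, eval_zero, norm_zero]
    positivity
  obtain ⟨C, hC, hCQ⟩ := exists_norm_eval_le P.derivative
  obtain ⟨c, hc, R, hR⟩ := exists_le_norm_eval hP
  refine ⟨max (max R 1) (C / (c * η)), fun z hz => ?_⟩
  have hz1 : 1 ≤ ‖z‖ := (le_max_right _ _).trans ((le_max_left _ _).trans hz)
  have hzR : R ≤ ‖z‖ := (le_max_left _ _).trans ((le_max_left _ _).trans hz)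
  have hzC : C / (c * η) ≤ ‖z‖ := (le_max_right _ _).trans hz
  rw [div_le_iff₀ (by positivity)] at hzC
  calc ‖P.derivative.eval z‖ ≤ C * ‖z‖ ^ P.derivative.natDegree := hCQ z hz1
    _ ≤ C * ‖z‖ ^ (P.natDegree - 1) := by
        gcongr
        exact natDegree_derivative_le P
    _ ≤ ‖z‖ * (c * η) * ‖z‖ ^ (P.natDegree - 1) := by gcongr
    _ = η * (c * ‖z‖ ^ P.natDegree) := by
        obtain ⟨m, hm⟩ := Nat.exists_eq_succ_of_ne_zero hd.ne'
        rw [hm]; simp only [Nat.succ_eq_add_one, Nat.add_sub_cancel]; ring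
    _ ≤ _ := by gcongr; exact hR z hzR

end PolynomialGrowth

/-! ### The function `P(z) sin(αz + β)` and its region of expansion -/

section PolySin

open Polynomial

/-- The entire function `z ↦ P(z) sin(αz + β)`. -/
noncomputable def polySin (α β : ℂ) (P : ℂ[X]) (z : ℂ) : ℂ :=
  P.eval z * Complex.sin (α * z + β)

/-- The points of modulus at least `R` whose distance to the line `Im(αz + β) = 0` grows at least
like the eighth root of the modulus. -/
def expandingRegion (α β : ℂ) (R : ℝ) : Set ℂ :=
  {z | R ≤ ‖z‖ ∧ 1 + ‖z‖ ≤ |(α * z + β).im| ^ 8}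

lemma expandingRegion_anti (α β : ℂ) {R R' : ℝ} (h : R ≤ R') :
    expandingRegion α β R' ⊆ expandingRegion α β R := fun _ hz => ⟨h.trans hz.1, hz.2⟩

lemma one_le_abs_im {α β : ℂ} {R : ℝ} {z : ℂ} (hz : z ∈ expandingRegion α β R) :
    1 ≤ |(α * z + β).im| := by
  by_contra! h
  have h1 := pow_le_one₀ (n := 8) (abs_nonneg (α * z + β).im) h.le
  have h2 := hz.2
  have h3 : ‖z‖ = 0 := le_antisymm (by linarith) (norm_nonneg z)
  have h4 : |(α * z + β).im| ^ 8 < 1 := pow_lt_one₀ (abs_nonneg _) h (by norm_num)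
  linarith

lemma measurableSet_expandingRegion (α β : ℂ) (R : ℝ) :
    MeasurableSet (expandingRegion α β R) := by
  apply IsClosed.measurableSet
  refine (isClosed_le continuous_const continuous_norm).inter
    (isClosed_le (f := fun z : ℂ => 1 + ‖z‖) (by fun_prop) ?_)
  have : Continuous fun z : ℂ => α * z + β := by fun_prop
  exact (Complex.continuous_im.comp this).abs.pow 8

lemma hasDerivAt_polySin (α β : ℂ) (P : ℂ[X]) (z : ℂ) :
    HasDerivAt (polySin α β P) (P.derivative.eval z * Complex.sin (α * z + β) +
      α * P.eval z * Complex.cos (α * z + β)) z := by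
  have h1 : HasDerivAt (fun z : ℂ => α * z + β) α z := by
    simpa using ((hasDerivAt_id z).const_mul α).add_const β
  convert! (P.hasDerivAt z).mul h1.csin using 1
  ring

lemma hasDerivAt_deriv_polySin (α β : ℂ) (P : ℂ[X]) (z : ℂ) :
    HasDerivAt (deriv (polySin α β P)) (P.derivative.derivative.eval z * Complex.sin (α * z + β) +
      2 * α * P.derivative.eval z * Complex.cos (α * z + β) -
      α ^ 2 * P.eval z * Complex.sin (α * z + β)) z := by
  have h0 : deriv (polySin α β P) = fun z => P.derivative.eval z * Complex.sin (α * z + β) +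
      α * (P.eval z * Complex.cos (α * z + β)) := by
    ext z; rw [(hasDerivAt_polySin α β P z).deriv]; ring
  have h1 : HasDerivAt (fun z : ℂ => α * z + β) α z := by
    simpa using ((hasDerivAt_id z).const_mul α).add_const β
  rw [h0]
  convert! ((P.derivative.hasDerivAt z).mul h1.csin).add
    (((P.hasDerivAt z).mul h1.ccos).const_mul α) using 1
  ring

lemma differentiable_polySin (α β : ℂ) (P : ℂ[X]) : Differentiable ℂ (polySin α β P) :=
  fun z => (hasDerivAt_polySin α β P z).differentiableAt

lemma norm_polySin_le (α β : ℂ) (P : ℂ[X]) (z : ℂ) :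
    ‖polySin α β P z‖ ≤ ‖P.eval z‖ * Real.exp |(α * z + β).im| := by
  rw [polySin, norm_mul]
  gcongr
  exact norm_sin_le _

lemma le_norm_polySin (α β : ℂ) (P : ℂ[X]) {z : ℂ} (hz : 1 ≤ |(α * z + β).im|) :
    ‖P.eval z‖ * Real.exp |(α * z + β).im| / 4 ≤ ‖polySin α β P z‖ := by
  rw [polySin, norm_mul, mul_div_assoc]
  gcongr
  exact le_norm_sin _ hz

lemma exists_le_norm_deriv_polySin {α : ℂ} (hα : α ≠ 0) (β : ℂ) {P : ℂ[X]} (hP : P ≠ 0) :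
    ∃ R : ℝ, ∀ z ∈ expandingRegion α β R,
      ‖α‖ / 8 * (‖P.eval z‖ * Real.exp |(α * z + β).im|) ≤ ‖deriv (polySin α β P) z‖ := by
  have hα' : 0 < ‖α‖ := norm_pos_iff.2 hα
  obtain ⟨R, hR⟩ := exists_norm_eval_derivative_le hP (η := ‖α‖ / 8) (by positivity)
  refine ⟨R, fun z hz => ?_⟩
  have h1 := hR z hz.1
  rw [(hasDerivAt_polySin α β P z).deriv]
  have h2 := norm_sub_norm_le (α * P.eval z * Complex.cos (α * z + β))
    (-(P.derivative.eval z * Complex.sin (α * z + β)))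
  rw [sub_neg_eq_add, norm_neg, norm_mul, norm_mul, norm_mul, add_comm (α * _ * _)] at h2
  have h3 : ‖α‖ * ‖P.eval z‖ * (Real.exp |(α * z + β).im| / 4) ≤
      ‖α‖ * ‖P.eval z‖ * ‖Complex.cos (α * z + β)‖ := by
    gcongr
    exact le_norm_cos _ (one_le_abs_im hz)
  have h4 : ‖P.derivative.eval z‖ * ‖Complex.sin (α * z + β)‖ ≤
      ‖α‖ / 8 * ‖P.eval z‖ * Real.exp |(α * z + β).im| := by
    gcongr
    exact norm_sin_le _
  linarith

lemma exists_mul_norm_polySin_le {α : ℂ} (hα : α ≠ 0) (β : ℂ) {P : ℂ[X]} (hP : P ≠ 0) :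
    ∃ c : ℝ, 0 < c ∧ ∃ R : ℝ, ∀ z ∈ expandingRegion α β R,
      c * ‖polySin α β P z‖ ≤ ‖deriv (polySin α β P) z‖ := by
  have hα' : 0 < ‖α‖ := norm_pos_iff.2 hα
  obtain ⟨R, hR⟩ := exists_le_norm_deriv_polySin hα β hP
  refine ⟨‖α‖ / 8, by positivity, R, fun z hz => le_trans ?_ (hR z hz)⟩
  gcongr
  exact norm_polySin_le α β P z

lemma exists_norm_deriv_deriv_polySin_le (α β : ℂ) {P : ℂ[X]} (hP : P ≠ 0) :
    ∃ B : ℝ, 0 < B ∧ ∃ R : ℝ, ∀ z : ℂ, R ≤ ‖z‖ → ∀ w ∈ ball z 1,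
      ‖deriv (deriv (polySin α β P)) w‖ ≤ B * (‖P.eval z‖ * Real.exp |(α * z + β).im|) := by
  obtain ⟨K₀, hK₀, R₀, h₀⟩ := exists_norm_eval_add_le hP le_rfl
  have hd1 : P.derivative.natDegree ≤ P.natDegree :=
    (natDegree_derivative_le P).trans (Nat.sub_le _ _)
  obtain ⟨K₁, hK₁, R₁, h₁⟩ := exists_norm_eval_add_le hP hd1
  obtain ⟨K₂, hK₂, R₂, h₂⟩ := exists_norm_eval_add_le (Q := P.derivative.derivative) hP
    (((natDegree_derivative_le _).trans (Nat.sub_le _ _)).trans hd1)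
  refine ⟨(K₂ + 2 * ‖α‖ * K₁ + ‖α‖ ^ 2 * K₀) * Real.exp ‖α‖, by positivity,
    max R₀ (max R₁ R₂), fun z hz w hw => ?_⟩
  simp only [max_le_iff] at hz
  have e0 := h₀ z hz.1 w hw
  have e1 := h₁ z hz.2.1 w hw
  have e2 := h₂ z hz.2.2 w hw
  have hwz : ‖w - z‖ ≤ 1 := by rw [mem_ball, dist_eq_norm] at hw; exact hw.le
  have him : |(α * w + β).im| ≤ ‖α‖ + |(α * z + β).im| := by
    have h1 : (α * w + β).im = (α * (w - z)).im + (α * z + β).im := by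
      rw [← Complex.add_im]; congr 1; ring
    rw [h1]
    refine (abs_add_le _ _).trans ?_
    gcongr
    refine (Complex.abs_im_le_norm _).trans ?_
    rw [norm_mul]
    exact mul_le_of_le_one_right (norm_nonneg _) hwz
  have hexp : Real.exp |(α * w + β).im| ≤ Real.exp ‖α‖ * Real.exp |(α * z + β).im| := by
    rw [← Real.exp_add]; exact Real.exp_le_exp.2 him
  set X := Real.exp ‖α‖ * Real.exp |(α * z + β).im| with hX
  have hs : ‖Complex.sin (α * w + β)‖ ≤ X := (norm_sin_le _).trans hexp
  have hc : ‖Complex.cos (α * w + β)‖ ≤ X := (norm_cos_le _).trans hexp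
  rw [(hasDerivAt_deriv_polySin α β P w).deriv]
  calc _ ≤ ‖P.derivative.derivative.eval w‖ * ‖Complex.sin (α * w + β)‖ +
        2 * ‖α‖ * ‖P.derivative.eval w‖ * ‖Complex.cos (α * w + β)‖ +
        ‖α‖ ^ 2 * ‖P.eval w‖ * ‖Complex.sin (α * w + β)‖ := by
        refine (norm_sub_le _ _).trans (add_le_add ((norm_add_le _ _).trans ?_) ?_)
        · simp only [norm_mul, Complex.norm_ofNat, le_refl]
        · simp only [norm_mul, norm_pow, le_refl]
    _ ≤ (K₂ * ‖P.eval z‖) * X + 2 * ‖α‖ * (K₁ * ‖P.eval z‖) * X +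
        ‖α‖ ^ 2 * (K₀ * ‖P.eval z‖) * X := by gcongr
    _ = _ := by rw [hX]; ring

lemma exists_injOn_polySin {α : ℂ} (hα : α ≠ 0) (β : ℂ) {P : ℂ[X]} (hP : P ≠ 0) :
    ∃ δ : ℝ, 0 < δ ∧ ∃ R : ℝ, ∀ z ∈ expandingRegion α β R,
      InjOn (polySin α β P) (ball z δ) := by
  have hα' : 0 < ‖α‖ := norm_pos_iff.2 hα
  obtain ⟨R₁, h₁⟩ := exists_le_norm_deriv_polySin hα β hP
  obtain ⟨B, hB, R₂, h₂⟩ := exists_norm_deriv_deriv_polySin_le α β hP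
  obtain ⟨p, hp, R₃, h₃⟩ := exists_le_norm_eval hP
  refine ⟨min 1 (‖α‖ / (16 * B)), by positivity, max (max R₁ R₂) (max R₃ 1),
    fun z hz => ?_⟩
  have hzn := hz.1
  simp only [max_le_iff] at hzn
  have hz1 : z ∈ expandingRegion α β R₁ := expandingRegion_anti α β
    ((le_max_left _ _).trans (le_max_left _ _)) hz
  set δ := min 1 (‖α‖ / (16 * B)) with hδ
  set E := ‖P.eval z‖ * Real.exp |(α * z + β).im| with hE
  have hEpos : 0 < E := by
    have : 0 < ‖P.eval z‖ := by
      refine lt_of_lt_of_le ?_ (h₃ z hzn.2.1)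
      have : 0 < ‖z‖ := by linarith
      positivity
    positivity
  have hBδ : B * E * δ ≤ ‖α‖ / 16 * E := by
    have : δ ≤ ‖α‖ / (16 * B) := min_le_right _ _
    calc B * E * δ ≤ B * E * (‖α‖ / (16 * B)) := by gcongr
      _ = _ := by field_simp
  have hδ1 : ball z δ ⊆ ball z 1 := ball_subset_ball (min_le_left _ _)
  have hδpos : 0 < δ := by positivity
  set f := polySin α β P with hf
  have hderiv : ∀ w ∈ ball z δ, ‖deriv f w - deriv f z‖ ≤ ‖α‖ / 16 * E := by
    intro w hw
    refine le_trans ((convex_ball z δ).norm_image_sub_le_of_norm_deriv_le (f := deriv f)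
      (fun x _ => (hasDerivAt_deriv_polySin α β P x).differentiableAt)
      (fun x hx => h₂ z hzn.1.2 x (hδ1 hx)) (mem_ball_self hδpos) hw) ?_
    refine le_trans ?_ hBδ
    gcongr
    rw [mem_ball, dist_eq_norm] at hw
    exact hw.le
  intro x hx y hy hxy
  have hlip := (convex_ball z δ).norm_image_sub_le_of_norm_deriv_le
    (f := fun w => f w - deriv f z * w) (C := ‖α‖ / 16 * E)
    (fun w _ => (differentiable_polySin α β P w).sub (by fun_prop))
    (fun w hw => by
      have h1 : HasDerivAt (fun w => f w - deriv f z * w) (deriv f w - deriv f z) w := by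
        simpa only [id, mul_one] using! (differentiable_polySin α β P w).hasDerivAt.sub
          ((hasDerivAt_id w).const_mul (deriv f z))
      rw [h1.deriv]
      exact hderiv w hw) hx hy
  have hlow := h₁ z hz1
  rw [← hxy] at hlip
  have h5 : f x - deriv f z * y - (f x - deriv f z * x) = - (deriv f z * (y - x)) := by ring
  simp only [h5, norm_neg, norm_mul] at hlip
  by_contra hne
  have hpos : 0 < ‖y - x‖ := norm_pos_iff.2 (sub_ne_zero.2 (Ne.symm hne))
  have := le_of_mul_le_mul_right hlip hpos
  have : ‖α‖ / 8 * E ≤ ‖α‖ / 16 * E := hlow.trans this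
  nlinarith [mul_pos hα' hEpos]

lemma exists_log_norm_polySin_le (α β : ℂ) (P : ℂ[X]) :
    ∃ C : ℝ, 0 < C ∧ ∀ z : ℂ, 1 ≤ ‖z‖ → 1 ≤ ‖polySin α β P z‖ →
      Real.log ‖polySin α β P z‖ ≤ C * ‖z‖ := by
  obtain ⟨C, hC, h⟩ := exists_norm_eval_le P
  refine ⟨|Real.log C| + P.natDegree + ‖α‖ + ‖β‖ + 1, by positivity, fun z hz hf => ?_⟩
  have hz0 : 0 < ‖z‖ := by linarith
  have h1 : ‖polySin α β P z‖ ≤ C * ‖z‖ ^ P.natDegree * Real.exp |(α * z + β).im| :=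
    (norm_polySin_le α β P z).trans (by gcongr; exact h z hz)
  have h2 := Real.log_le_log (by linarith) h1
  rw [Real.log_mul (by positivity) (by positivity), Real.log_mul (by positivity) (by positivity),
    Real.log_pow, Real.log_exp] at h2
  have h3 : |(α * z + β).im| ≤ ‖α‖ * ‖z‖ + ‖β‖ := by
    refine (Complex.abs_im_le_norm _).trans ((norm_add_le _ _).trans ?_)
    rw [norm_mul]
  have h4 : Real.log ‖z‖ ≤ ‖z‖ := (Real.log_le_sub_one_of_pos hz0).trans (by linarith)
  have h5 : Real.log C ≤ |Real.log C| * ‖z‖ :=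
    (le_abs_self _).trans (le_mul_of_one_le_right (abs_nonneg _) hz)
  have h6 : ‖β‖ ≤ ‖β‖ * ‖z‖ := le_mul_of_one_le_right (norm_nonneg _) hz
  have h7 : (P.natDegree : ℝ) * Real.log ‖z‖ ≤ P.natDegree * ‖z‖ := by gcongr
  nlinarith

lemma exists_growth_polySin (α β : ℂ) {P : ℂ[X]} (hP : P ≠ 0) {M : ℝ} (hM : 0 < M) :
    ∃ R : ℝ, ∀ z ∈ expandingRegion α β R, M * (1 + ‖z‖) ^ 8 ≤ ‖polySin α β P z‖ := by
  obtain ⟨p, hp, R, hR⟩ := exists_le_norm_eval hP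
  have hlim := Real.tendsto_pow_mul_exp_neg_atTop_nhds_zero 64
  obtain ⟨Y, hY⟩ := eventually_atTop.1 (hlim.eventually_le_const (u := p / (4 * M)) (by positivity))
  refine ⟨max (max R 1) (max Y 0 ^ 8), fun z hz => ?_⟩
  have hzn := hz.1
  simp only [max_le_iff] at hzn
  set y := |(α * z + β).im| with hy
  have hYy : Y ≤ y := by
    refine (le_max_left Y 0).trans ?_
    refine le_of_pow_le_pow_left₀ (n := 8) (by norm_num) (abs_nonneg _) ?_
    exact hzn.2.trans ((by linarith : ‖z‖ ≤ 1 + ‖z‖).trans hz.2)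
  have h1 := hY y hYy
  have h2 : p ≤ ‖P.eval z‖ := by
    refine le_trans ?_ (hR z hzn.1.1)
    exact le_mul_of_one_le_right hp.le (one_le_pow₀ hzn.1.2)
  have h3 : M * y ^ 64 ≤ p * Real.exp y / 4 := by
    rw [Real.exp_neg, ← div_eq_mul_inv, div_le_iff₀ (Real.exp_pos y)] at h1
    calc M * y ^ 64 ≤ M * (p / (4 * M) * Real.exp y) := by gcongr
      _ = _ := by field_simp
  have hz8 : (1 + ‖z‖) ^ 8 ≤ y ^ 64 := by
    calc (1 + ‖z‖) ^ 8 ≤ (y ^ 8) ^ 8 := by gcongr; exact hz.2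
      _ = y ^ 64 := by rw [← pow_mul]
  calc M * (1 + ‖z‖) ^ 8 ≤ M * y ^ 64 := by gcongr
    _ ≤ p * Real.exp y / 4 := h3
    _ ≤ ‖P.eval z‖ * Real.exp y / 4 := by gcongr
    _ ≤ _ := le_norm_polySin α β P (one_le_abs_im hz)

end PolySin

/-! ### Holomorphic functions avoiding the unit disc -/

section LogDerivative

lemma exists_exp_eq {F : ℂ → ℂ} (hF : Differentiable ℂ F) {z : ℂ} {ε : ℝ}
    (hne : ∀ w ∈ ball z ε, F w ≠ 0) :
    ∃ h : ℂ → ℂ, ∀ w ∈ ball z ε, HasDerivAt h (deriv F w / F w) w ∧ Complex.exp (h w) = F w := by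
  rcases le_or_gt ε 0 with hε | hε
  · exact ⟨0, fun w hw => by simp [ball_eq_empty.2 hε] at hw⟩
  have hdF : Differentiable ℂ (deriv F) := hF.deriv
  have hd : DifferentiableOn ℂ (fun w => deriv F w / F w) (ball z ε) := fun w hw =>
    ((hdF w).div (hF w) (hne w hw)).differentiableWithinAt
  obtain ⟨h, hh⟩ := hd.isExactOn_ball.with_val_at z (Complex.log (F z))
  refine ⟨h, fun w hw => ⟨hh.2 w hw, ?_⟩⟩
  have hz := mem_ball_self hε (x := z)
  have hconst : ∀ x ∈ ball z ε, HasDerivAt (fun x => F x * Complex.exp (-h x)) 0 x := by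
    intro x hx
    convert! (hF x).hasDerivAt.mul (hh.2 x hx).neg.cexp using 1
    field_simp [hne x hx]
    ring
  have := (convex_ball z ε).is_const_of_fderivWithin_eq_zero (𝕜 := ℂ)
    (f := fun x => F x * Complex.exp (-h x))
    (fun x hx => (hconst x hx).differentiableAt.differentiableWithinAt)
    (fun x hx => by
      rw [fderivWithin_of_isOpen isOpen_ball hx]
      ext
      simpa using (hconst x hx).deriv) hw hz
  simp only [hh.1, Complex.exp_neg, Complex.exp_log (hne z hz)] at this
  rw [mul_inv_cancel₀ (hne z hz), mul_inv_eq_one₀ (Complex.exp_ne_zero _)] at this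
  exact this.symm

lemma norm_sub_le_norm_add_conj {a b : ℂ} (ha : 0 ≤ a.re) (hb : 0 ≤ b.re) :
    ‖a - b‖ ≤ ‖a + (starRingEnd ℂ) b‖ := by
  refine le_of_sq_le_sq ?_ (norm_nonneg _)
  rw [← Complex.normSq_eq_norm_sq, ← Complex.normSq_eq_norm_sq, Complex.normSq_apply,
    Complex.normSq_apply]
  simp only [Complex.sub_re, Complex.sub_im, Complex.add_re, Complex.add_im, Complex.conj_re,
    Complex.conj_im]
  nlinarith [mul_nonneg ha hb]

/-- A logarithmic derivative estimate of Borel–Carathéodory type. -/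
lemma norm_deriv_le_mul_log {F : ℂ → ℂ} (hF : Differentiable ℂ F) {z : ℂ} {ε : ℝ} (hε : 0 < ε)
    (hge : ∀ w ∈ ball z ε, 1 ≤ ‖F w‖) (hz : 1 < ‖F z‖) :
    ‖deriv F z‖ ≤ 4 / ε * (‖F z‖ * Real.log ‖F z‖) := by
  have hne : ∀ w ∈ ball z ε, F w ≠ 0 := fun w hw =>
    norm_pos_iff.1 (zero_lt_one.trans_le (hge w hw))
  obtain ⟨h, hh⟩ := exists_exp_eq hF hne
  have hre : ∀ w ∈ ball z ε, (h w).re = Real.log ‖F w‖ := by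
    intro w hw
    rw [← (hh w hw).2, Complex.norm_exp, Real.log_exp]
  have hre0 : ∀ w ∈ ball z ε, 0 ≤ (h w).re := fun w hw => by
    rw [hre w hw]; exact Real.log_nonneg (hge w hw)
  have hzb : z ∈ ball z ε := mem_ball_self hε
  have hL : 0 < Real.log ‖F z‖ := Real.log_pos hz
  have hden : ∀ w ∈ ball z ε, h w + (starRingEnd ℂ) (h z) ≠ 0 := by
    intro w hw h0
    have := congrArg Complex.re h0
    simp only [Complex.add_re, Complex.conj_re, Complex.zero_re, hre z hzb] at this
    linarith [hre0 w hw]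
  have hqd : ∀ w ∈ ball z ε, DifferentiableAt ℂ
      (fun w => (h w - h z) / (h w + (starRingEnd ℂ) (h z))) w := fun w hw =>
    ((hh w hw).1.differentiableAt.sub_const _).div
      ((hh w hw).1.differentiableAt.add_const _) (hden w hw)
  have hball : closedBall z (ε / 2) ⊆ ball z ε := closedBall_subset_ball (by linarith)
  have hcauchy := Complex.norm_deriv_le_of_forall_mem_sphere_norm_le (c := z) (R := ε / 2) (C := 1)
    (f := fun w => (h w - h z) / (h w + (starRingEnd ℂ) (h z))) (by positivity)
    (DifferentiableOn.diffContOnCl (fun w hw => (hqd w (hball (closure_ball_subset_closedBall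
      hw))).differentiableWithinAt))
    (fun w hw => by
      have hw' := hball (sphere_subset_closedBall hw)
      rw [norm_div, div_le_one (norm_pos_iff.2 (hden w hw'))]
      exact norm_sub_le_norm_add_conj (hre0 w hw') (hre0 z hzb))
  have hq' : HasDerivAt (fun w => (h w - h z) / (h w + (starRingEnd ℂ) (h z)))
      (deriv F z / F z / (2 * Real.log ‖F z‖)) z := by
    have h2 : h z + (starRingEnd ℂ) (h z) = 2 * Real.log ‖F z‖ := by
      rw [Complex.add_conj, hre z hzb]; push_cast; ring
    have hL' : (Real.log ‖F z‖ : ℂ) ≠ 0 := by exact_mod_cast hL.ne'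
    convert! ((hh z hzb).1.sub_const (h z)).div ((hh z hzb).1.add_const _) (hden z hzb) using 1
    rw [h2, sub_self]
    have := hne z hzb
    field_simp
    ring
  rw [hq'.deriv, norm_div, norm_div, norm_mul, Complex.norm_real, Real.norm_of_nonneg hL.le,
    Complex.norm_ofNat] at hcauchy
  have hFz : 0 < ‖F z‖ := by linarith
  rw [div_div, div_le_iff₀ (by positivity)] at hcauchy
  calc _ ≤ _ := hcauchy
    _ = _ := by field_simp; norm_num

end LogDerivative

/-! ### Points whose orbit stays in a region of expansion belong to the Julia set -/

section Julia

lemma one_le_norm_of_chordalDist_lt {a b : ℂ} {γ : Option ℂ} (hb : 8 ≤ ‖b‖)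
    (hbγ : chordalDist (some b) γ < 1 / 2) (haγ : chordalDist (some a) γ < 1 / 2) :
    1 ≤ ‖a‖ := by
  by_contra! ha
  have ha2 : √(1 + ‖a‖ ^ 2) < 3 / 2 := by
    rw [Real.sqrt_lt' (by norm_num)]; nlinarith [norm_nonneg a]
  have ha0 : 0 < √(1 + ‖a‖ ^ 2) := Real.sqrt_pos.2 (by positivity)
  cases γ with
  | none =>
    rw [chordalDist, div_lt_iff₀ ha0] at haγ
    linarith
  | some v =>
    have hv0 : 0 < √(1 + ‖v‖ ^ 2) := Real.sqrt_pos.2 (by positivity)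
    have hb0 : 0 < √(1 + ‖b‖ ^ 2) := Real.sqrt_pos.2 (by positivity)
    rw [chordalDist, div_lt_iff₀ (by positivity)] at haγ hbγ
    have hb2 : √(1 + ‖b‖ ^ 2) ≤ 9 / 8 * ‖b‖ := by
      rw [Real.sqrt_le_left (by positivity)]; nlinarith
    have h1 := norm_sub_norm_le b v
    have h2 := norm_sub_norm_le v a
    rw [norm_sub_rev] at h2
    rcases le_or_gt ‖v‖ 2 with hv | hv
    · have hv2 : √(1 + ‖v‖ ^ 2) ≤ 9 / 4 := by
        rw [Real.sqrt_le_left (by norm_num)]; nlinarith [norm_nonneg v]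
      have : √(1 + ‖b‖ ^ 2) * √(1 + ‖v‖ ^ 2) ≤ 9 / 8 * ‖b‖ * (9 / 4) := by gcongr
      nlinarith
    · have hv2 : √(1 + ‖v‖ ^ 2) ≤ 9 / 8 * ‖v‖ := by
        rw [Real.sqrt_le_left (by positivity)]; nlinarith
      have : √(1 + ‖a‖ ^ 2) * √(1 + ‖v‖ ^ 2) ≤ 3 / 2 * (9 / 8 * ‖v‖) := by gcongr
      nlinarith

variable {f : ℂ → ℂ} {W : Set ℂ} {z : ℂ}

lemma two_pow_le_norm_iterate (h1 : ∀ z ∈ W, 1 ≤ ‖z‖) (hgrow : ∀ z ∈ W, 2 * ‖z‖ ≤ ‖f z‖)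
    (hz : ∀ n, f^[n] z ∈ W) (n : ℕ) : 2 ^ n ≤ ‖f^[n] z‖ := by
  induction n with
  | zero => simpa using h1 _ (hz 0)
  | succ n ih =>
    rw [Function.iterate_succ_apply', pow_succ']
    exact le_trans (by gcongr) (hgrow _ (hz n))

lemma mem_escapingSet_of_forall_iterate_mem (h1 : ∀ z ∈ W, 1 ≤ ‖z‖)
    (hgrow : ∀ z ∈ W, 2 * ‖z‖ ≤ ‖f z‖) (hz : ∀ n, f^[n] z ∈ W) : z ∈ escapingSet f :=
  tendsto_atTop_mono (two_pow_le_norm_iterate h1 hgrow hz)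
    (tendsto_pow_atTop_atTop_of_one_lt one_lt_two)

lemma deriv_iterate_succ (hf : Differentiable ℂ f) (n : ℕ) (z : ℂ) :
    deriv f^[n + 1] z = deriv f (f^[n] z) * deriv f^[n] z := by
  rw [Function.iterate_succ']
  exact deriv_comp z (hf _) (hf.iterate n z)

lemma le_norm_deriv_iterate (hf : Differentiable ℂ f) {c : ℝ} (hc : 0 < c)
    (hderiv : ∀ z ∈ W, c * ‖f z‖ ≤ ‖deriv f z‖) (h2 : ∀ z ∈ W, 2 ≤ c * ‖z‖)
    (hz : ∀ n, f^[n] z ∈ W) (n : ℕ) :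
    c ^ 2 * 2 ^ n * (‖f^[n + 1] z‖ * ‖f^[n + 2] z‖) ≤ ‖deriv f^[n + 2] z‖ := by
  have hd : ∀ n, c * ‖f^[n + 1] z‖ ≤ ‖deriv f (f^[n] z)‖ := fun n => by
    rw [Function.iterate_succ_apply']; exact hderiv _ (hz n)
  induction n with
  | zero =>
    rw [deriv_iterate_succ hf, deriv_iterate_succ hf, norm_mul, norm_mul]
    have h0 := hd 0
    have h1 := hd 1
    have : c ^ 2 * 2 ^ 0 * (‖f^[0 + 1] z‖ * ‖f^[0 + 2] z‖) =
      (c * ‖f^[1 + 1] z‖) * ((c * ‖f^[0 + 1] z‖) * ‖deriv f^[0] z‖) := by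
      simp; ring
    rw [this]
    gcongr
  | succ n ih =>
    rw [deriv_iterate_succ hf, norm_mul]
    calc c ^ 2 * 2 ^ (n + 1) * (‖f^[n + 2] z‖ * ‖f^[n + 3] z‖)
        = (c * ‖f^[n + 3] z‖) * (c * 2 ^ n * ‖f^[n + 2] z‖ * 2) := by ring
      _ ≤ (c * ‖f^[n + 3] z‖) * (c * 2 ^ n * ‖f^[n + 2] z‖ * (c * ‖f^[n + 1] z‖)) := by
          gcongr
          exact h2 _ (hz _)
      _ = (c * ‖f^[n + 3] z‖) * (c ^ 2 * 2 ^ n * (‖f^[n + 1] z‖ * ‖f^[n + 2] z‖)) := by ring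
      _ ≤ _ := by
          gcongr
          exact hd (n + 2)

lemma mem_juliaSet_of_forall_iterate_mem (hf : Differentiable ℂ f) {c C : ℝ} (hc : 0 < c)
    (hderiv : ∀ z ∈ W, c * ‖f z‖ ≤ ‖deriv f z‖) (hlog : ∀ z ∈ W, Real.log ‖f z‖ ≤ C * ‖z‖)
    (h1 : ∀ z ∈ W, 1 ≤ ‖z‖) (h2 : ∀ z ∈ W, 2 ≤ c * ‖z‖) (hgrow : ∀ z ∈ W, 2 * ‖z‖ ≤ ‖f z‖)
    (hz : ∀ n, f^[n] z ∈ W) : z ∈ juliaSet f := by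
  rintro ⟨U, hU, hnormal⟩
  obtain ⟨ψ, hψ, g, hg⟩ := hnormal id strictMono_id
  simp only [id] at hg
  have hbig := two_pow_le_norm_iterate h1 hgrow hz
  obtain ⟨r, hr, hrU⟩ := Metric.nhds_basis_closedBall.mem_iff.1 hU
  obtain ⟨k₀, hk₀⟩ := eventually_atTop.1
    (hg (closedBall z r) hrU (isCompact_closedBall z r) (1 / 2) (by norm_num))
  set k₁ := max k₀ 4 with hk₁
  have hz8 : 8 < ‖f^[ψ k₁] z‖ := by
    refine lt_of_lt_of_le ?_ (hbig _)
    have : 4 ≤ ψ k₁ := (le_max_right _ _).trans (hψ.id_le k₁)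
    calc (8 : ℝ) < 2 ^ 4 := by norm_num
      _ ≤ _ := pow_le_pow_right₀ one_le_two this
  have hcont : ContinuousAt (fun w => ‖f^[ψ k₁] w‖) z :=
    ((hf.continuous.iterate _).norm).continuousAt
  obtain ⟨r', hr', hball⟩ := Metric.eventually_nhds_iff_ball.1 (hcont.eventually_const_lt hz8)
  set ε := min r r' with hεdef
  have hε : 0 < ε := lt_min hr hr'
  have hge : ∀ k, k₀ ≤ k → ∀ w ∈ ball z ε, 1 ≤ ‖f^[ψ k] w‖ := by
    intro k hk w hw
    have hwr : w ∈ closedBall z r :=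
      ball_subset_closedBall (ball_subset_ball (min_le_left _ _) hw)
    have hwr' : w ∈ ball z r' := ball_subset_ball (min_le_right _ _) hw
    exact one_le_norm_of_chordalDist_lt (hball w hwr').le (hk₀ k₁ (le_max_left _ _) w hwr)
      (hk₀ k hk w hwr)
  obtain ⟨N, hN⟩ := pow_unbounded_of_one_lt (4 / ε * C / c ^ 2) (_root_.one_lt_two (α := ℝ))
  set k := max k₀ (N + 2) with hk
  obtain ⟨n, hn⟩ : ∃ n, ψ k = n + 2 ∧ N ≤ n := by
    have : N + 2 ≤ ψ k := (le_max_right _ _).trans (hψ.id_le k)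
    exact ⟨ψ k - 2, by omega, by omega⟩
  have hF := hge k (le_max_left _ _)
  rw [hn.1] at hF
  have hFz : 1 < ‖f^[n + 2] z‖ :=
    lt_of_lt_of_le (one_lt_pow₀ _root_.one_lt_two (Nat.succ_ne_zero _)) (hbig (n + 2))
  have hup := norm_deriv_le_mul_log (hf.iterate (n + 2)) hε hF hFz
  have hlow := le_norm_deriv_iterate hf hc hderiv h2 hz n
  have hl : Real.log ‖f^[n + 2] z‖ ≤ C * ‖f^[n + 1] z‖ := by
    rw [Function.iterate_succ_apply' f (n + 1)]; exact hlog _ (hz _)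
  have h3 : c ^ 2 * 2 ^ n * (‖f^[n + 1] z‖ * ‖f^[n + 2] z‖) ≤
      4 / ε * C * (‖f^[n + 1] z‖ * ‖f^[n + 2] z‖) := by
    calc _ ≤ _ := hlow.trans hup
      _ ≤ 4 / ε * (‖f^[n + 2] z‖ * (C * ‖f^[n + 1] z‖)) := by gcongr
      _ = _ := by ring
  have hp1 := h1 _ (hz (n + 1))
  have hp2 := h1 _ (hz (n + 2))
  have h4 := le_of_mul_le_mul_right h3 (by positivity)
  rw [div_lt_iff₀ (by positivity)] at hN
  have h5 : (2 : ℝ) ^ N * c ^ 2 ≤ c ^ 2 * 2 ^ n := by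
    rw [mul_comm]; gcongr
    · norm_num
    · exact hn.2
  linarith

end Julia

/-! ### A weighted area contracted by preimages -/

section WeightedArea


lemma abs_det_restrictScalars_toSpanSingleton (a : ℂ) :
    |((ContinuousLinearMap.toSpanSingleton ℂ a).restrictScalars ℝ : ℂ →L[ℝ] ℂ).det| =
      ‖a‖ ^ 2 := by
  have h : (((ContinuousLinearMap.toSpanSingleton ℂ a).restrictScalars ℝ : ℂ →L[ℝ] ℂ) :
      ℂ →ₗ[ℝ] ℂ) = LinearMap.mulLeft ℝ a := by
    ext; simp [mul_comm]
  have h2 : LinearMap.det (LinearMap.mulLeft ℝ a) = Complex.normSq a := by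
    rw [← Algebra.norm_complex_apply, Algebra.norm_apply]; rfl
  rw [ContinuousLinearMap.det, h, h2, Complex.normSq_eq_norm_sq, abs_of_nonneg (by positivity)]

lemma lintegral_image_eq_lintegral_norm_deriv_sq_mul {f : ℂ → ℂ} (hf : Differentiable ℂ f)
    {s : Set ℂ} (hs : MeasurableSet s) (hinj : InjOn f s) (g : ℂ → ℝ≥0∞) :
    ∫⁻ w in f '' s, g w = ∫⁻ z in s, ENNReal.ofReal (‖deriv f z‖ ^ 2) * g (f z) := by
  rw [lintegral_image_eq_lintegral_abs_det_fderiv_mul volume hs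
    (f' := fun z => (ContinuousLinearMap.toSpanSingleton ℂ (deriv f z)).restrictScalars ℝ)
    (fun z _ => ((hf z).hasDerivAt.hasFDerivAt.restrictScalars ℝ).hasFDerivWithinAt) hinj]
  simp only [abs_det_restrictScalars_toSpanSingleton]

/-- The measure with density `(1 + |z|) ^ (-3/2)`, which dominates the logarithmic area. -/
noncomputable def weightedArea : Measure ℂ :=
  volume.withDensity fun z => ENNReal.ofReal ((1 + ‖z‖) ^ (-(3 / 2) : ℝ))

lemma measurable_weight :
    Measurable fun z : ℂ => ENNReal.ofReal ((1 + ‖z‖) ^ (-(3 / 2) : ℝ)) := by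
  fun_prop

instance : SFinite weightedArea := by unfold weightedArea; infer_instance

lemma weightedArea_le_mul_image {f : ℂ → ℂ} (hf : Differentiable ℂ f) {s : Set ℂ}
    (hs : MeasurableSet s) (hinj : InjOn f s) {κ : ℝ≥0∞}
    (hκ : ∀ z ∈ s, ENNReal.ofReal ((1 + ‖z‖) ^ (-(3 / 2) : ℝ)) ≤
      κ * (ENNReal.ofReal (‖deriv f z‖ ^ 2) *
        ENNReal.ofReal ((1 + ‖f z‖) ^ (-(3 / 2) : ℝ)))) :
    weightedArea s ≤ κ * weightedArea (f '' s) := by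
  have hfm := hf.continuous.measurable
  have hdm := measurable_deriv f
  calc weightedArea s = ∫⁻ z in s, ENNReal.ofReal ((1 + ‖z‖) ^ (-(3 / 2) : ℝ)) :=
        withDensity_apply _ hs
    _ ≤ ∫⁻ z in s, κ * (ENNReal.ofReal (‖deriv f z‖ ^ 2) *
        ENNReal.ofReal ((1 + ‖f z‖) ^ (-(3 / 2) : ℝ))) := setLIntegral_mono' hs hκ
    _ = κ * ∫⁻ w in f '' s, ENNReal.ofReal ((1 + ‖w‖) ^ (-(3 / 2) : ℝ)) := by
        rw [lintegral_const_mul _ (by fun_prop),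
          lintegral_image_eq_lintegral_norm_deriv_sq_mul hf hs hinj]
    _ ≤ _ := by gcongr; exact withDensity_apply_le _ _

lemma one_add_norm_rpow_le {z ξ : ℂ} (h : dist z ξ ≤ 1) :
    (1 + ‖z‖) ^ (-4 : ℝ) ≤ 16 * (1 + ‖ξ‖) ^ (-4 : ℝ) := by
  have h1 : 1 + ‖ξ‖ ≤ 2 * (1 + ‖z‖) := by
    have := norm_sub_norm_le ξ z
    rw [dist_comm, dist_eq_norm] at h
    linarith [norm_nonneg z]
  calc (1 + ‖z‖) ^ (-4 : ℝ) = 16 * (2 * (1 + ‖z‖)) ^ (-4 : ℝ) := by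
        rw [Real.mul_rpow (by norm_num) (by positivity), ← mul_assoc,
          show (2 : ℝ) ^ (-4 : ℝ) = 1 / 16 by
            rw [Real.rpow_neg (by norm_num)]; norm_num]
        norm_num
    _ ≤ _ := by
        gcongr ?_ * ?_
        exact Real.rpow_le_rpow_of_nonpos (by positivity) h1 (by norm_num)

/-- Holomorphic maps which are injective on balls of a fixed radius and sufficiently expanding
contract the weighted area under preimages. -/
lemma exists_weightedArea_preimage_le {δ : ℝ} (hδ : 0 < δ) (hδ1 : δ ≤ 1) :
    ∃ D : ℝ≥0∞, D ≠ ∞ ∧ ∀ (f : ℂ → ℂ) (W : Set ℂ) (η : ℝ≥0∞), Differentiable ℂ f →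
      MeasurableSet W → (∀ z ∈ W, InjOn f (ball z (2 * δ))) →
      (∀ z ∈ W, ENNReal.ofReal ((1 + ‖z‖) ^ (-(3 / 2) : ℝ)) ≤
        η * ENNReal.ofReal ((1 + ‖z‖) ^ (-4 : ℝ)) * (ENNReal.ofReal (‖deriv f z‖ ^ 2) *
          ENNReal.ofReal ((1 + ‖f z‖) ^ (-(3 / 2) : ℝ)))) →
      ∀ A : Set ℂ, MeasurableSet A → weightedArea (W ∩ f ⁻¹' A) ≤ η * D * weightedArea A := by
  set J : ℝ≥0∞ := ∫⁻ ξ : ℂ, ENNReal.ofReal ((1 + ‖ξ‖) ^ (-4 : ℝ)) with hJ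
  have hJfin : J ≠ ∞ := (finite_integral_one_add_norm (E := ℂ) (μ := volume) (r := 4)
    (by rw [Complex.finrank_real_complex]; norm_num)).ne
  set v : ℝ≥0∞ := volume (ball (0 : ℂ) δ) with hv
  have hv0 : v ≠ 0 := (measure_ball_pos volume _ hδ).ne'
  have hvt : v ≠ ∞ := measure_ball_lt_top.ne
  refine ⟨16 * J / v, ENNReal.div_ne_top (ENNReal.mul_ne_top (by norm_num) hJfin) hv0,
    fun f W η hf hW hinj hexp A hA => ?_⟩
  set S := W ∩ f ⁻¹' A with hS
  have hSm : MeasurableSet S := hW.inter (hf.continuous.measurable hA)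
  have hU : MeasurableSet {p : ℂ × ℂ | dist p.1 p.2 < δ} :=
    (isOpen_lt (by fun_prop) (by fun_prop)).measurableSet
  have h1 : (weightedArea.restrict S).prod volume {p : ℂ × ℂ | dist p.1 p.2 < δ} =
      v * weightedArea S := by
    rw [Measure.prod_apply hU]
    have : ∀ z : ℂ, volume (Prod.mk z ⁻¹' {p : ℂ × ℂ | dist p.1 p.2 < δ}) = v := by
      intro z
      have : Prod.mk z ⁻¹' {p : ℂ × ℂ | dist p.1 p.2 < δ} = ball z δ := by
        ext ξ; simp [dist_comm]
      rw [this, hv, Measure.addHaar_ball_center]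
    simp only [this, lintegral_const, Measure.restrict_apply_univ]
  have h2 : ∀ ξ : ℂ, weightedArea.restrict S
      ((fun z => (z, ξ)) ⁻¹' {p : ℂ × ℂ | dist p.1 p.2 < δ}) ≤
        η * (16 * ENNReal.ofReal ((1 + ‖ξ‖) ^ (-4 : ℝ))) * weightedArea A := by
    intro ξ
    have hpre : (fun z => (z, ξ)) ⁻¹' {p : ℂ × ℂ | dist p.1 p.2 < δ} = ball ξ δ := rfl
    rw [hpre, Measure.restrict_apply measurableSet_ball]
    rcases (ball ξ δ ∩ S).eq_empty_or_nonempty with he | ⟨z₀, hz₀⟩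
    · rw [he, measure_empty]; exact zero_le
    have hsub : ball ξ δ ∩ S ⊆ ball z₀ (2 * δ) := fun z hz => by
      have h3 := mem_ball.1 hz.1
      have h4 := mem_ball'.1 hz₀.1
      rw [mem_ball]
      linarith [dist_triangle z ξ z₀]
    calc weightedArea (ball ξ δ ∩ S)
        ≤ η * (16 * ENNReal.ofReal ((1 + ‖ξ‖) ^ (-4 : ℝ))) *
            weightedArea (f '' (ball ξ δ ∩ S)) := by
          refine weightedArea_le_mul_image hf (measurableSet_ball.inter hSm)
            ((hinj z₀ hz₀.2.1).mono hsub) fun z hz => (hexp z hz.2.1).trans ?_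
          gcongr
          rw [← ENNReal.ofReal_ofNat 16, ← ENNReal.ofReal_mul (by norm_num)]
          exact ENNReal.ofReal_le_ofReal (one_add_norm_rpow_le ((mem_ball.1 hz.1).le.trans hδ1))
      _ ≤ _ := by
          gcongr
          rintro _ ⟨z, hz, rfl⟩
          exact hz.2.2
  have h3 : v * weightedArea S ≤ η * (16 * J) * weightedArea A := by
    rw [← h1, Measure.prod_apply_symm hU]
    refine (lintegral_mono h2).trans_eq ?_
    rw [lintegral_mul_const _ (by fun_prop), lintegral_const_mul _ (by fun_prop),
      lintegral_const_mul _ (by fun_prop)]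
  rw [mul_comm v, ← ENNReal.le_div_iff_mul_le (Or.inl hv0) (Or.inl hvt)] at h3
  refine h3.trans_eq ?_
  simp only [div_eq_mul_inv]
  ring

lemma weightedArea_ball_lt_top (R : ℝ) : weightedArea (ball 0 R) < ∞ := by
  rw [weightedArea, withDensity_apply _ measurableSet_ball]
  refine lt_of_le_of_lt (setLIntegral_mono (g := fun _ => 1) measurable_const fun z _ => ?_) ?_
  · rw [ENNReal.ofReal_le_one]
    exact Real.rpow_le_one_of_one_le_of_nonpos (by linarith [norm_nonneg z]) (by norm_num)
  · rw [setLIntegral_one]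
    exact measure_ball_lt_top

lemma lintegral_japanese_mul_cauchy_lt_top :
    ∫⁻ ζ : ℂ, ENNReal.ofReal ((1 + ‖ζ.re‖) ^ (-(5 / 4) : ℝ)) *
      ENNReal.ofReal ((1 + ζ.im ^ 2)⁻¹) < ∞ := by
  have h := Complex.volume_preserving_equiv_real_prod.lintegral_comp_emb
    Complex.measurableEquivRealProd.measurableEmbedding
    (fun p : ℝ × ℝ => ENNReal.ofReal ((1 + ‖p.1‖) ^ (-(5 / 4) : ℝ)) *
      ENNReal.ofReal ((1 + p.2 ^ 2)⁻¹))
  have h' : ∫⁻ ζ : ℂ, ENNReal.ofReal ((1 + ‖ζ.re‖) ^ (-(5 / 4) : ℝ)) *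
      ENNReal.ofReal ((1 + ζ.im ^ 2)⁻¹) = _ := h
  rw [h', Measure.volume_eq_prod, lintegral_prod_mul (f := fun x : ℝ =>
    ENNReal.ofReal ((1 + ‖x‖) ^ (-(5 / 4) : ℝ))) (g := fun y : ℝ =>
    ENNReal.ofReal ((1 + y ^ 2)⁻¹)) (by fun_prop) (by fun_prop)]
  refine ENNReal.mul_lt_top ?_ ?_
  · exact finite_integral_one_add_norm (E := ℝ) (μ := volume) (by norm_num)
  · exact integrable_inv_one_add_sq.lintegral_lt_top

lemma weight_le_of_pow_le {t x y L : ℝ} (ht : 1 ≤ t) (hx : 1 + ‖x‖ ≤ L * t) (hL : 0 < L)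
    (hy : |y| ^ 8 ≤ t) :
    t ^ (-(3 / 2) : ℝ) ≤
      2 * L ^ (5 / 4 : ℝ) * ((1 + ‖x‖) ^ (-(5 / 4) : ℝ) * (1 + y ^ 2)⁻¹) := by
  have ht0 : 0 < t := by linarith
  have hy2 : y ^ 2 ≤ t ^ (1 / 4 : ℝ) := by
    calc y ^ 2 = (|y| ^ 8) ^ (1 / 4 : ℝ) := by
          rw [← Real.rpow_natCast |y| 8, ← Real.rpow_mul (abs_nonneg y), ← sq_abs,
            ← Real.rpow_natCast |y| 2]
          norm_num
      _ ≤ _ := by gcongr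
  have h1 : 1 ≤ t ^ (1 / 4 : ℝ) := Real.one_le_rpow ht (by norm_num)
  have h2 : (2 * t ^ (1 / 4 : ℝ))⁻¹ ≤ (1 + y ^ 2)⁻¹ := by gcongr; linarith
  have h3 : (L * t) ^ (-(5 / 4) : ℝ) ≤ (1 + ‖x‖) ^ (-(5 / 4) : ℝ) :=
    Real.rpow_le_rpow_of_nonpos (by positivity) hx (by norm_num)
  calc t ^ (-(3 / 2) : ℝ)
      = 2 * L ^ (5 / 4 : ℝ) * ((L * t) ^ (-(5 / 4) : ℝ) * (2 * t ^ (1 / 4 : ℝ))⁻¹) := by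
        rw [Real.mul_rpow hL.le ht0.le, Real.rpow_neg hL.le, mul_inv, ← Real.rpow_neg ht0.le,
          show (-(3 / 2) : ℝ) = -(5 / 4) + -(1 / 4) by norm_num, Real.rpow_add ht0]
        field_simp
    _ ≤ _ := by gcongr

lemma weightedArea_compl_expandingRegion_lt_top {α : ℂ} (hα : α ≠ 0) (β : ℂ) (R : ℝ) :
    weightedArea (expandingRegion α β R)ᶜ < ∞ := by
  have hα' : 0 < ‖α‖ := norm_pos_iff.2 hα
  set B : Set ℂ := {z | |(α * z + β).im| ^ 8 ≤ 1 + ‖z‖} with hB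
  have haff : Continuous fun z : ℂ => α * z + β := by fun_prop
  have hBm : MeasurableSet B :=
    (isClosed_le ((Complex.continuous_im.comp haff).abs.pow 8)
      (by fun_prop)).measurableSet
  have hsub : (expandingRegion α β R)ᶜ ⊆ ball 0 R ∪ B := by
    intro z hz
    rcases lt_or_ge ‖z‖ R with h | h
    · exact Or.inl (by simpa using h)
    · refine Or.inr (not_lt.1 fun h' => hz ⟨h, h'.le⟩)
  refine lt_of_le_of_lt ((measure_mono hsub).trans (measure_union_le _ _))
    (ENNReal.add_lt_top.2 ⟨weightedArea_ball_lt_top R, ?_⟩)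
  set L := 1 + ‖α‖ + ‖β‖ with hL
  set G : ℂ → ℝ≥0∞ := fun ζ => ENNReal.ofReal ((1 + ‖ζ.re‖) ^ (-(5 / 4) : ℝ)) *
      ENNReal.ofReal ((1 + ζ.im ^ 2)⁻¹) with hG
  have hGfin : ∫⁻ z : ℂ, G (α * z + β) < ∞ := by
    have hder : ∀ z, HasDerivAt (fun z : ℂ => α * z + β) α z := fun z => by
      simpa using ((hasDerivAt_id z).const_mul α).add_const β
    have h := lintegral_image_eq_lintegral_norm_deriv_sq_mul
      (f := fun z => α * z + β) (by fun_prop) MeasurableSet.univ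
      (fun x _ y _ hxy => mul_left_cancel₀ hα (add_right_cancel hxy)) G
    have hsurj : (fun z => α * z + β) '' univ = univ := by
      rw [image_univ, range_eq_univ]
      exact fun w => ⟨(w - β) / α, by simp only; field_simp; ring⟩
    rw [hsurj] at h
    simp only [(hder _).deriv, Measure.restrict_univ] at h
    rw [lintegral_const_mul' _ _ ENNReal.ofReal_ne_top] at h
    have h2 := lintegral_japanese_mul_cauchy_lt_top
    rw [h] at h2
    refine ENNReal.lt_top_of_mul_ne_top_right h2.ne ?_
    rw [ne_eq, ENNReal.ofReal_eq_zero, not_le]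
    positivity
  rw [weightedArea, withDensity_apply _ hBm]
  calc ∫⁻ z in B, ENNReal.ofReal ((1 + ‖z‖) ^ (-(3 / 2) : ℝ))
      ≤ ∫⁻ z in B, ENNReal.ofReal (2 * L ^ (5 / 4 : ℝ)) * G (α * z + β) := by
        refine setLIntegral_mono' hBm fun z hz => ?_
        simp only [hG]
        rw [← ENNReal.ofReal_mul (by positivity), ← ENNReal.ofReal_mul (by positivity)]
        refine ENNReal.ofReal_le_ofReal (weight_le_of_pow_le (by linarith [norm_nonneg z]) ?_
          (by positivity) hz)
        have h1 : ‖(α * z + β).re‖ ≤ ‖α‖ * ‖z‖ + ‖β‖ := by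
          refine (Complex.abs_re_le_norm _).trans ((norm_add_le _ _).trans ?_)
          rw [norm_mul]
        have := norm_nonneg z
        have := norm_nonneg β
        rw [hL]
        nlinarith [mul_nonneg (norm_nonneg β) (norm_nonneg z)]
    _ ≤ ∫⁻ z, ENNReal.ofReal (2 * L ^ (5 / 4 : ℝ)) * G (α * z + β) := setLIntegral_le_lintegral _ _
    _ = ENNReal.ofReal (2 * L ^ (5 / 4 : ℝ)) * ∫⁻ z, G (α * z + β) :=
        lintegral_const_mul' _ _ ENNReal.ofReal_ne_top
    _ < ∞ := ENNReal.mul_lt_top ENNReal.ofReal_lt_top hGfin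

lemma weightedArea_univ : weightedArea univ = ∞ := by
  refine ENNReal.eq_top_of_forall_nnreal_le fun m => ?_
  set s : ℝ := 2 * m + 2 with hs
  have hs2 : 2 ≤ s := by rw [hs]; linarith [NNReal.coe_nonneg m]
  have hs0 : 0 < s := by linarith
  have hr : 0 ≤ s ^ 2 - 1 := by nlinarith
  have h1 : ENNReal.ofReal (s ^ 3)⁻¹ * volume (ball (0 : ℂ) (s ^ 2 - 1)) ≤
      weightedArea univ := by
    refine le_trans ?_ (measure_mono (subset_univ (ball (0 : ℂ) (s ^ 2 - 1))))
    rw [weightedArea, withDensity_apply _ measurableSet_ball, ← setLIntegral_const]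
    refine setLIntegral_mono measurable_weight fun z hz => ENNReal.ofReal_le_ofReal ?_
    rw [mem_ball_zero_iff] at hz
    calc (s ^ 3)⁻¹ = (s ^ 2) ^ (-(3 / 2) : ℝ) := by
          rw [← Real.rpow_natCast s 2, ← Real.rpow_mul hs0.le, ← Real.rpow_natCast s 3,
            ← Real.rpow_neg hs0.le]
          norm_num
      _ ≤ _ := Real.rpow_le_rpow_of_nonpos (by positivity) (by linarith) (by norm_num)
  refine le_trans ?_ h1
  rw [Complex.volume_ball, ← ENNReal.ofReal_pow hr, ENNReal.coe_nnreal_eq,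
    ENNReal.coe_nnreal_eq, ← ENNReal.ofReal_mul (by positivity),
    ← ENNReal.ofReal_mul (by positivity)]
  refine ENNReal.ofReal_le_ofReal ?_
  rw [NNReal.coe_real_pi, inv_mul_eq_div, le_div_iff₀ (by positivity)]
  have h2 : (3 / 4 * s ^ 2) ^ 2 ≤ (s ^ 2 - 1) ^ 2 := by gcongr; nlinarith
  have h3 : (3 / 4 * s ^ 2) ^ 2 * 3 ≤ (s ^ 2 - 1) ^ 2 * Real.pi := by
    gcongr
    exact Real.pi_gt_three.le
  refine le_trans ?_ h3
  have hm : (m : ℝ) ≤ s := by rw [hs]; linarith [NNReal.coe_nonneg m]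
  calc (m : ℝ) * s ^ 3 ≤ s * s ^ 3 := by gcongr
    _ ≤ _ := by nlinarith [pow_pos hs0 4]

end WeightedArea

/-! ### The set of points whose orbit stays in the expanding region -/

section Orbits

/-- The points of `W` whose whole forward orbit under `f` stays in `W`. -/
def invariantPart (f : ℂ → ℂ) (W : Set ℂ) : Set ℂ := {z | ∀ n, f^[n] z ∈ W}

/-- If `f` halves the measure of preimages inside `W`, then almost no mass escapes from `W`. -/
lemma measure_compl_invariantPart_lt_top {f : ℂ → ℂ} (hf : Measurable f) {W : Set ℂ}
    (hW : MeasurableSet W) {μ : Measure ℂ} (hfin : μ Wᶜ < ∞)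
    (hcontr : ∀ A : Set ℂ, MeasurableSet A → μ (W ∩ f ⁻¹' A) ≤ 2⁻¹ * μ A) :
    μ (invariantPart f W)ᶜ < ∞ := by
  let E : ℕ → Set ℂ := fun n => (fun A => W ∩ f ⁻¹' A)^[n] Wᶜ
  have hE : ∀ n, E (n + 1) = W ∩ f ⁻¹' E n := fun n =>
    Function.iterate_succ_apply' (fun A => W ∩ f ⁻¹' A) n Wᶜ
  have hEm : ∀ n, MeasurableSet (E n) := by
    intro n
    induction n with
    | zero => exact hW.compl
    | succ n ih => rw [hE]; exact hW.inter (hf ih)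
  have hEμ : ∀ n, μ (E n) ≤ 2⁻¹ ^ n * μ Wᶜ := by
    intro n
    induction n with
    | zero => simp [E]
    | succ n ih =>
      rw [hE, pow_succ', mul_assoc]
      exact (hcontr _ (hEm n)).trans (by gcongr)
  have hexit : ∀ n z, f^[n] z ∉ W → z ∈ ⋃ n, E n := by
    intro n
    induction n with
    | zero => exact fun z hz => mem_iUnion.2 ⟨0, hz⟩
    | succ n ih =>
      intro z hz
      by_cases hzW : z ∈ W
      · rw [Function.iterate_succ_apply] at hz
        obtain ⟨m, hm⟩ := mem_iUnion.1 (ih (f z) hz)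
        exact mem_iUnion.2 ⟨m + 1, by rw [hE]; exact ⟨hzW, hm⟩⟩
      · exact mem_iUnion.2 ⟨0, hzW⟩
  have hsub : (invariantPart f W)ᶜ ⊆ ⋃ n, E n := by
    intro z hz
    obtain ⟨n, hn⟩ := not_forall.1 hz
    exact hexit n z hn
  calc μ (invariantPart f W)ᶜ ≤ ∑' n, μ (E n) := (measure_mono hsub).trans (measure_iUnion_le _)
    _ ≤ ∑' n, 2⁻¹ ^ n * μ Wᶜ := ENNReal.tsum_le_tsum hEμ
    _ = 2 * μ Wᶜ := by
        rw [ENNReal.tsum_mul_right, ENNReal.tsum_geometric, ENNReal.one_sub_inv_two, inv_inv]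
    _ < ∞ := ENNReal.mul_lt_top (by norm_num) hfin

end Orbits

lemma logArea_Delta_diff_le {S T : Set ℂ} (hST : S ⊆ T) :
    logArea (Delta \ T) ≤ 4 * weightedArea Sᶜ := by
  have hD : MeasurableSet Delta := (isClosed_le continuous_const continuous_norm).measurableSet
  have hpt : ∀ z ∈ Delta, ENNReal.ofReal ((‖z‖ ^ 2)⁻¹) ≤
      4 * ENNReal.ofReal ((1 + ‖z‖) ^ (-(3 / 2) : ℝ)) := by
    intro z hz
    have hz1 : 1 ≤ ‖z‖ := hz
    rw [← ENNReal.ofReal_ofNat 4, ← ENNReal.ofReal_mul (by norm_num)]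
    refine ENNReal.ofReal_le_ofReal ?_
    have h1 : (1 + ‖z‖) ^ (-2 : ℝ) ≤ (1 + ‖z‖) ^ (-(3 / 2) : ℝ) :=
      Real.rpow_le_rpow_of_exponent_le (by linarith) (by norm_num)
    rw [Real.rpow_neg (by positivity), Real.rpow_two] at h1
    have h2 : (‖z‖ ^ 2)⁻¹ ≤ 4 * ((1 + ‖z‖) ^ 2)⁻¹ := by
      rw [← div_eq_mul_inv, le_div_iff₀ (by positivity), inv_mul_le_iff₀ (by positivity)]
      nlinarith
    linarith
  calc logArea (Delta \ T)
      ≤ ∫⁻ z in Delta ∩ Sᶜ, ENNReal.ofReal ((‖z‖ ^ 2)⁻¹) :=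
        lintegral_mono_set (inter_subset_inter_right _ (compl_subset_compl.2 hST))
    _ = ∫⁻ z in Delta, ENNReal.ofReal ((‖z‖ ^ 2)⁻¹) ∂(volume.restrict Sᶜ) := by
        rw [Measure.restrict_restrict hD]
    _ ≤ ∫⁻ z in Delta, 4 * ENNReal.ofReal ((1 + ‖z‖) ^ (-(3 / 2) : ℝ)) ∂(volume.restrict Sᶜ) :=
        setLIntegral_mono' hD hpt
    _ ≤ ∫⁻ z in Sᶜ, 4 * ENNReal.ofReal ((1 + ‖z‖) ^ (-(3 / 2) : ℝ)) :=
        setLIntegral_le_lintegral _ _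
    _ = 4 * ∫⁻ z in Sᶜ, ENNReal.ofReal ((1 + ‖z‖) ^ (-(3 / 2) : ℝ)) :=
        lintegral_const_mul _ measurable_weight
    _ ≤ _ := by gcongr; exact withDensity_apply_le _ _

/-- The pointwise expansion estimate behind the contraction of the weighted area. -/
lemma weight_le_mul_deriv_sq {t F d c η M : ℝ} (ht : 1 ≤ t) (hc : 0 < c) (hη : 0 < η)
    (hM1 : 1 ≤ M) (hM : 8 ≤ M * (η * c ^ 2)) (hF : M ^ 2 * t ^ 8 ≤ F) (hd : c * F ≤ d) :
    t ^ (-(3 / 2) : ℝ) ≤ η * t ^ (-4 : ℝ) * (d ^ 2 * (1 + F) ^ (-(3 / 2) : ℝ)) := by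
  have ht0 : 0 < t := by linarith
  have hF1 : 1 ≤ F := le_trans (one_le_mul_of_one_le_of_one_le (one_le_pow₀ hM1)
    (one_le_pow₀ ht)) hF
  have hF0 : 0 < F := by linarith
  have hsq : M * t ^ 4 ≤ F ^ (1 / 2 : ℝ) := by
    rw [← Real.sqrt_eq_rpow]
    refine Real.le_sqrt_of_sq_le (le_of_eq_of_le ?_ hF)
    ring
  have h1 : F ^ (-(3 / 2) : ℝ) / 8 ≤ (1 + F) ^ (-(3 / 2) : ℝ) := by
    calc F ^ (-(3 / 2) : ℝ) / 8 = (4 * F) ^ (-(3 / 2) : ℝ) := by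
          rw [Real.mul_rpow (by norm_num) hF0.le, show (4 : ℝ) = 2 ^ (2 : ℝ) by norm_num,
            ← Real.rpow_mul zero_le_two, show (2 * (-(3 / 2)) : ℝ) = -3 by norm_num,
            Real.rpow_neg zero_le_two]
          norm_num
          ring
      _ ≤ _ := Real.rpow_le_rpow_of_nonpos (by positivity) (by linarith) (by norm_num)
  have h2 : F ^ 2 * F ^ (-(3 / 2) : ℝ) = F ^ (1 / 2 : ℝ) := by
    rw [← Real.rpow_natCast, ← Real.rpow_add hF0]; norm_num
  calc t ^ (-(3 / 2) : ℝ) ≤ 1 := Real.rpow_le_one_of_one_le_of_nonpos ht (by norm_num)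
    _ ≤ M * (η * c ^ 2) / 8 := by linarith
    _ = η * t ^ (-4 : ℝ) * (c ^ 2 * (M * t ^ 4) / 8) := by
        rw [Real.rpow_neg ht0.le]
        norm_cast
        field_simp
    _ ≤ η * t ^ (-4 : ℝ) * (c ^ 2 * F ^ (1 / 2 : ℝ) / 8) := by gcongr
    _ = η * t ^ (-4 : ℝ) * ((c * F) ^ 2 * (F ^ (-(3 / 2) : ℝ) / 8)) := by rw [← h2]; ring
    _ ≤ _ := by gcongr

lemma exists_subset_escapingSet_inter_juliaSet {α : ℂ} (hα : α ≠ 0) (β : ℂ) {P : Polynomial ℂ}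
    (hP : P ≠ 0) :
    ∃ S ⊆ escapingSet (polySin α β P) ∩ juliaSet (polySin α β P), weightedArea Sᶜ < ∞ := by
  obtain ⟨c, hc, R₁, h₁⟩ := exists_mul_norm_polySin_le hα β hP
  obtain ⟨δ₀, hδ₀, R₂, h₂⟩ := exists_injOn_polySin hα β hP
  obtain ⟨C, hC, h₃⟩ := exists_log_norm_polySin_le α β P
  set δ := min 1 (δ₀ / 2) with hδ
  have hδδ : 2 * δ ≤ δ₀ := by linarith [min_le_right 1 (δ₀ / 2)]
  obtain ⟨D, hD, hcontr⟩ := exists_weightedArea_preimage_le (δ := δ) (by positivity)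
    (min_le_left _ _)
  set η : ℝ := (2 * (D.toReal + 1))⁻¹ with hη
  have hD0 : 0 ≤ D.toReal := ENNReal.toReal_nonneg
  have hηpos : 0 < η := by positivity
  have hηD : ENNReal.ofReal η * D ≤ 2⁻¹ := by
    rw [← ENNReal.ofReal_toReal hD, ← ENNReal.ofReal_mul hηpos.le, ← ENNReal.ofReal_ofNat 2,
      ← ENNReal.ofReal_inv_of_pos (by norm_num)]
    refine ENNReal.ofReal_le_ofReal ?_
    rw [hη, inv_mul_le_iff₀ (by positivity)]
    linarith
  set M : ℝ := max 2 (8 / (η * c ^ 2)) with hM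
  have hM2 : 2 ≤ M := le_max_left _ _
  obtain ⟨R₄, h₄⟩ := exists_growth_polySin α β hP (M := M ^ 2) (by positivity)
  set R := max (max R₁ R₂) (max R₄ (max 1 (2 / c))) with hR
  set W := expandingRegion α β R with hW
  have hWm : MeasurableSet W := measurableSet_expandingRegion α β R
  have hW₁ : W ⊆ expandingRegion α β R₁ :=
    expandingRegion_anti α β ((le_max_left _ _).trans (le_max_left _ _))
  have hW₂ : W ⊆ expandingRegion α β R₂ :=
    expandingRegion_anti α β ((le_max_right _ _).trans (le_max_left _ _))
  have hW₄ : W ⊆ expandingRegion α β R₄ :=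
    expandingRegion_anti α β ((le_max_left _ _).trans (le_max_right _ _))
  have hnorm : ∀ z ∈ W, max 1 (2 / c) ≤ ‖z‖ := fun z hz =>
    ((le_max_right _ _).trans (le_max_right _ _)).trans hz.1
  have hone : ∀ z ∈ W, 1 ≤ ‖z‖ := fun z hz => (le_max_left _ _).trans (hnorm z hz)
  have htwo : ∀ z ∈ W, 2 ≤ c * ‖z‖ := fun z hz => by
    have := (le_max_right _ _).trans (hnorm z hz)
    rwa [div_le_iff₀' hc] at this
  have hgrow : ∀ z ∈ W, 2 * ‖z‖ ≤ ‖polySin α β P z‖ := by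
    intro z hz
    refine le_trans ?_ (h₄ z (hW₄ hz))
    have h5 : 1 + ‖z‖ ≤ (1 + ‖z‖) ^ 8 :=
      le_self_pow₀ (by linarith [norm_nonneg z]) (by norm_num)
    have h6 : 2 ≤ M ^ 2 := by nlinarith
    calc 2 * ‖z‖ ≤ 2 * (1 + ‖z‖) := by linarith
      _ ≤ _ := by gcongr
  have hlog : ∀ z ∈ W, Real.log ‖polySin α β P z‖ ≤ C * ‖z‖ := fun z hz =>
    h₃ z (hone z hz) (by linarith [hgrow z hz, hone z hz])
  have hdiff := differentiable_polySin α β P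
  refine ⟨invariantPart (polySin α β P) W, fun z hz =>
    ⟨mem_escapingSet_of_forall_iterate_mem hone hgrow hz,
      mem_juliaSet_of_forall_iterate_mem hdiff hc (fun z hz => h₁ z (hW₁ hz)) hlog hone htwo
        hgrow hz⟩, ?_⟩
  refine measure_compl_invariantPart_lt_top hdiff.continuous.measurable hWm
    (weightedArea_compl_expandingRegion_lt_top hα β R) fun A hA => ?_
  refine (hcontr (polySin α β P) W (ENNReal.ofReal η) hdiff hWm
    (fun z hz => (h₂ z (hW₂ hz)).mono (ball_subset_ball hδδ)) (fun z hz => ?_) A hA).trans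
    (by gcongr)
  rw [← ENNReal.ofReal_mul hηpos.le, ← ENNReal.ofReal_mul (by positivity),
    ← ENNReal.ofReal_mul (by positivity)]
  refine ENNReal.ofReal_le_ofReal (weight_le_mul_deriv_sq (by linarith [norm_nonneg z]) hc hηpos
    (by linarith) ?_ (h₄ z (hW₄ hz)) (h₁ z (hW₁ hz)))
  rw [← div_le_iff₀ (by positivity)]
  exact le_max_right _ _

theorem julia_positive_measure_poly_sin
    (α β : ℂ) (hα : α ≠ 0) (P : Polynomial ℂ) (hP : P ≠ 0) :
    logArea (Delta \
        (escapingSet (fun z => P.eval z * Complex.sin (α * z + β)) ∩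
          juliaSet (fun z => P.eval z * Complex.sin (α * z + β)))) < ⊤ ∧
      0 < volume (juliaSet (fun z => P.eval z * Complex.sin (α * z + β))) := by
  obtain ⟨S, hS, hfin⟩ := exists_subset_escapingSet_inter_juliaSet hα β hP
  refine ⟨(logArea_Delta_diff_le hS).trans_lt (ENNReal.mul_lt_top (by norm_num) hfin), ?_⟩
  refine pos_iff_ne_zero.2 fun h0 => ?_
  have hS0 : volume S = 0 := measure_mono_null (hS.trans inter_subset_right) h0
  have hS1 : weightedArea S = 0 := withDensity_absolutelyContinuous _ _ hS0
  have := measure_univ_le_add_compl (μ := weightedArea) S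
  rw [weightedArea_univ, hS1, zero_add, top_le_iff] at this
  exact hfin.ne this
end

section
/- Let f be a transcendental entire function, ε > 0, and X = {z ∈ ℂ : f(z) ≠ 0 and |z f'(z)/f(z)| ≥ n(|z|)^{1/2+ε}}. Let R > 1 and K ∈ ℕ with 2^K ≤ n(R). Then for every measurable set S ⊆ ℂ of finite logarithmic area, logarea(f^{-1}(S) ∩ X ∩ {z : |z| ≥ R}) ≤ (2^{1−2εK}/(1 − 2^{−2ε})) · logarea S. -/
open MeasureTheory Filter Metric Set Topology ENNReal

/-- The vanishing order is at most the analytic order. -/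
lemma natCast_vanishingOrder_le_analyticOrderAt {g : ℂ → ℂ} {z : ℂ} (hg : AnalyticAt ℂ g z) :
    (vanishingOrder g z : ℕ∞) ≤ analyticOrderAt g z := by
  rw [natCast_le_analyticOrderAt_iff_iteratedDeriv_eq_zero hg]
  intro i hi
  by_contra h
  exact Nat.notMem_of_lt_sInf hi h

lemma exists_eq_pow_mul_of_le_analyticOrderAt {h : ℂ → ℂ} (hh : Differentiable ℂ h) {u : ℂ}
    {n : ℕ} (hn : (n : ℕ∞) ≤ analyticOrderAt h u) :
    ∃ k : ℂ → ℂ, Differentiable ℂ k ∧ ∀ z, h z = (z - u) ^ n * k z := by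
  induction n generalizing h with
  | zero => exact ⟨h, hh, by simp⟩
  | succ n ih =>
    have h0 : h u = 0 := by
      apply apply_eq_zero_of_analyticOrderAt_ne_zero (𝕜 := ℂ)
      intro h0
      rw [h0] at hn
      simp at hn
    have hd : Differentiable ℂ (dslope h u) := by
      rw [← differentiableOn_univ, Complex.differentiableOn_dslope univ_mem]
      exact hh.differentiableOn
    have heq : h = (fun z => z - u) * dslope h u := by
      funext z
      have := sub_smul_dslope h u z
      simp only [smul_eq_mul, h0, sub_zero] at this
      simp [this]
    have ho : analyticOrderAt h u = 1 + analyticOrderAt (dslope h u) u := by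
      conv_lhs => rw [heq]
      rw [analyticOrderAt_mul (by fun_prop) (hd.analyticAt u)]
      congr 1
      exact analyticOrderAt_id_sub_const_self
    rw [ho, Nat.cast_add, Nat.cast_one, add_comm,
      ENat.add_le_add_iff_left (by simp)] at hn
    obtain ⟨k, hk, hkz⟩ := ih hd hn
    refine ⟨k, hk, fun z => ?_⟩
    rw [congrFun heq z, Pi.mul_apply, hkz z]
    ring

lemma exists_eq_prod_pow_mul_of_le_analyticOrderAt {h : ℂ → ℂ} (hh : Differentiable ℂ h)
    (F : Finset ℂ) (n : ℂ → ℕ) (hn : ∀ u ∈ F, (n u : ℕ∞) ≤ analyticOrderAt h u) :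
    ∃ k : ℂ → ℂ, Differentiable ℂ k ∧ ∀ z, h z = (∏ u ∈ F, (z - u) ^ n u) * k z := by
  induction F using Finset.induction_on with
  | empty => exact ⟨h, hh, by simp⟩
  | insert u F hu ih =>
    obtain ⟨k, hk, hkz⟩ := ih fun v hv => hn v (Finset.mem_insert_of_mem hv)
    have hP : AnalyticAt ℂ (fun z : ℂ => ∏ v ∈ F, (z - v) ^ n v) u := by fun_prop
    have hP0 : analyticOrderAt (fun z : ℂ => ∏ v ∈ F, (z - v) ^ n v) u = 0 := by
      rw [hP.analyticOrderAt_eq_zero, Finset.prod_ne_zero_iff]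
      intro v hv
      exact pow_ne_zero _ (sub_ne_zero.2 fun h => hu (h ▸ hv))
    have ho : analyticOrderAt h u = analyticOrderAt k u := by
      have : h = (fun z : ℂ => ∏ v ∈ F, (z - v) ^ n v) * k := funext hkz
      rw [this, analyticOrderAt_mul hP (hk.analyticAt u), hP0, zero_add]
    obtain ⟨l, hl, hlz⟩ := exists_eq_pow_mul_of_le_analyticOrderAt hk
      (ho ▸ hn u (Finset.mem_insert_self u F))
    refine ⟨l, hl, fun z => ?_⟩
    rw [hkz, hlz, Finset.prod_insert hu]
    ring

/-- A Jensen-type bound for the number of zeros of an entire function in a disc. -/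
lemma two_pow_sum_mul_norm_le {h : ℂ → ℂ} (hh : Differentiable ℂ h) {c : ℂ} {s M : ℝ}
    (hs : 0 < s) (hM : ∀ z ∈ closedBall c (3 * s), ‖h z‖ ≤ M) (F : Finset ℂ) (n : ℂ → ℕ)
    (hF : ∀ u ∈ F, u ∈ closedBall c s) (hn : ∀ u ∈ F, (n u : ℕ∞) ≤ analyticOrderAt h u) :
    2 ^ (∑ u ∈ F, n u) * ‖h c‖ ≤ M := by
  obtain ⟨k, hk, hkz⟩ := exists_eq_prod_pow_mul_of_le_analyticOrderAt hh F n hn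
  set N := ∑ u ∈ F, n u with hN
  have hkc : ‖k c‖ ≤ M / (2 * s) ^ N := by
    refine Complex.norm_le_of_forall_mem_frontier_norm_le (U := ball c (3 * s)) isBounded_ball
      hk.diffContOnCl (fun z hz => ?_) (subset_closure (mem_ball_self (by positivity)))
    rw [frontier_ball c (by positivity), mem_sphere, dist_eq_norm] at hz
    rw [le_div_iff₀ (by positivity), mul_comm]
    refine le_trans ?_ (hM z (by rw [mem_closedBall, dist_eq_norm, hz]))
    rw [hkz z, norm_mul, norm_prod, hN, ← Finset.prod_pow_eq_pow_sum]
    gcongr with u hu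
    rw [norm_pow]
    gcongr
    have h1 := hF u hu
    rw [mem_closedBall, dist_eq_norm] at h1
    have h2 := norm_sub_norm_le (z - c) (u - c)
    rw [sub_sub_sub_cancel_right] at h2
    linarith
  have hc : ‖h c‖ ≤ s ^ N * (M / (2 * s) ^ N) := by
    rw [hkz c, norm_mul, norm_prod, hN, ← Finset.prod_pow_eq_pow_sum, ← hN]
    gcongr with u hu
    rw [norm_pow]
    gcongr
    have h1 := hF u hu
    rwa [mem_closedBall, dist_comm, dist_eq_norm] at h1
  calc 2 ^ N * ‖h c‖ ≤ 2 ^ N * (s ^ N * (M / (2 * s) ^ N)) := by gcongr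
    _ = M := by rw [mul_pow]; field_simp

lemma exists_ne_of_not_polynomial {f : ℂ → ℂ}
    (hf : ¬ ∃ p : Polynomial ℂ, ∀ z, f z = p.eval z) : ∃ c, f 0 ≠ f c := by
  by_contra! h
  exact hf ⟨Polynomial.C (f 0), fun z => by simp [h z]⟩

/-- The number of `a`-points in a disc, with multiplicity, is bounded uniformly in `a`. -/
lemma exists_forall_sum_vanishingOrder_le {f : ℂ → ℂ} (hf : TranscendentalEntire f) (r : ℝ) :
    ∃ C : ℕ, ∀ (a : ℂ) (F : Finset ℂ), (∀ u ∈ F, ‖u‖ ≤ r ∧ f u = a) →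
      ∑ u ∈ F, vanishingOrder (fun w => f w - a) u ≤ C := by
  obtain ⟨hd, hp⟩ := hf
  obtain ⟨b, hb⟩ := exists_ne_of_not_polynomial hp
  set s : ℝ := |r| + ‖b‖ + 1 with hs_def
  have hs : 0 < s := by positivity
  obtain ⟨M, hM⟩ := (isCompact_closedBall (0 : ℂ) (4 * s)).exists_bound_of_continuousOn
    hd.continuous.continuousOn
  set δ : ℝ := ‖f 0 - f b‖ / 2 with hδ_def
  have hδ : 0 < δ := by
    have := norm_pos_iff.2 (sub_ne_zero.2 hb)
    positivity
  obtain ⟨C, hC⟩ := pow_unbounded_of_one_lt (2 * M / δ) (one_lt_two)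
  refine ⟨C, fun a F hF => ?_⟩
  rcases F.eq_empty_or_nonempty with rfl | ⟨u₀, hu₀⟩
  · simp
  have hr : r ≤ |r| := le_abs_self r
  have hb0 := norm_nonneg b
  have hr0 := abs_nonneg r
  have ha : ‖a‖ ≤ M := by
    rw [← (hF u₀ hu₀).2]
    refine hM _ ?_
    rw [mem_closedBall_zero_iff]
    linarith [(hF u₀ hu₀).1]
  have hg : Differentiable ℂ fun w => f w - a := hd.sub_const a
  have key : ∀ c : ℂ, ‖c‖ ≤ ‖b‖ → δ ≤ ‖f c - a‖ →
      ∑ u ∈ F, vanishingOrder (fun w => f w - a) u ≤ C := by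
    intro c hc hδc
    have h1 := two_pow_sum_mul_norm_le hg (c := c) (M := 2 * M) hs (fun z hz => ?_) F
      (vanishingOrder fun w => f w - a) (fun u hu => ?_)
      (fun u _ => natCast_vanishingOrder_le_analyticOrderAt (hg.analyticAt u))
    · have h2 : (2 : ℝ) ^ (∑ u ∈ F, vanishingOrder (fun w => f w - a) u) ≤ 2 * M / δ := by
        rw [le_div_iff₀ hδ]
        exact le_trans (by gcongr) h1
      exact ((_root_.pow_lt_pow_iff_right₀ (one_lt_two (α := ℝ))).1 (h2.trans_lt hC)).le
    · rw [mem_closedBall, dist_eq_norm] at hz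
      have h3 := norm_le_norm_add_norm_sub' z c
      have h4 := hM z (by rw [mem_closedBall_zero_iff]; linarith)
      linarith [norm_sub_le (f z) a]
    · rw [mem_closedBall, dist_eq_norm]
      linarith [norm_sub_le u c, (hF u hu).1]
  rcases le_or_gt δ ‖f 0 - a‖ with h | h
  · exact key 0 (by simp) h
  · refine key b le_rfl ?_
    have h5 : ‖f 0 - f b‖ ≤ ‖f 0 - a‖ + ‖f b - a‖ := by
      rw [norm_sub_rev (f b) a]
      exact norm_sub_le_norm_sub_add_norm_sub _ _ _
    linarith

lemma one_le_vanishingOrder {f : ℂ → ℂ} (hf : TranscendentalEntire f) {a u : ℂ}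
    (hu : f u = a) : 1 ≤ vanishingOrder (fun w => f w - a) u := by
  obtain ⟨hd, hp⟩ := hf
  have hg : Differentiable ℂ fun w => f w - a := hd.sub_const a
  have hne : {k : ℕ | iteratedDeriv k (fun w => f w - a) u ≠ 0}.Nonempty := by
    by_contra hemp
    rw [Set.not_nonempty_iff_eq_empty, Set.eq_empty_iff_forall_notMem] at hemp
    have htop : analyticOrderAt (fun w => f w - a) u = ⊤ := by
      refine ENat.eq_top_iff_forall_ge.2 fun m => ?_
      rw [natCast_le_analyticOrderAt_iff_iteratedDeriv_eq_zero (hg.analyticAt u)]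
      intro i _
      by_contra h
      exact hemp i h
    rw [analyticOrderAt_eq_top] at htop
    have hzero : (fun w => f w - a) = 0 :=
      AnalyticOnNhd.eq_of_eventuallyEq (fun z _ => hg.analyticAt z)
        (fun z _ => analyticAt_const) htop
    exact hp ⟨Polynomial.C a, fun z => by simpa [sub_eq_zero] using congrFun hzero z⟩
  rw [Nat.one_le_iff_ne_zero]
  intro h0
  have hmem := Nat.sInf_mem hne
  rw [vanishingOrder] at h0
  rw [h0] at hmem
  simp [hu] at hmem

lemma finite_setOf_norm_le_and_eq {f : ℂ → ℂ} (hf : TranscendentalEntire f) (a : ℂ) (r : ℝ) :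
    {z : ℂ | ‖z‖ ≤ r ∧ f z = a}.Finite := by
  obtain ⟨C, hC⟩ := exists_forall_sum_vanishingOrder_le hf r
  by_contra hinf
  obtain ⟨F, hF, hcard⟩ := Set.Infinite.exists_subset_card_eq hinf (C + 1)
  have h1 := hC a F fun u hu => hF hu
  have h2 : F.card ≤ ∑ u ∈ F, vanishingOrder (fun w => f w - a) u := by
    rw [Finset.card_eq_sum_ones]
    exact Finset.sum_le_sum fun u hu => one_le_vanishingOrder hf (hF hu).2
  omega

lemma nCount_eq_sum {f : ℂ → ℂ} (hf : TranscendentalEntire f) (a : ℂ) (r : ℝ) :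
    nCount f a r = ∑ z ∈ (finite_setOf_norm_le_and_eq hf a r).toFinset,
      vanishingOrder (fun w => f w - a) z :=
  finsum_mem_eq_finite_toFinset_sum _ _

lemma bddAbove_range_nCount {f : ℂ → ℂ} (hf : TranscendentalEntire f) (r : ℝ) :
    BddAbove (range fun a => nCount f a r) := by
  obtain ⟨C, hC⟩ := exists_forall_sum_vanishingOrder_le hf r
  refine ⟨C, ?_⟩
  rintro _ ⟨a, rfl⟩
  simp only [nCount_eq_sum hf]
  exact hC a _ fun u hu => by simpa using hu

lemma nMax_monotone {f : ℂ → ℂ} (hf : TranscendentalEntire f) : Monotone (nMax f) := by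
  intro r t hrt
  refine ciSup_mono (bddAbove_range_nCount hf t) fun a => ?_
  rw [nCount_eq_sum hf, nCount_eq_sum hf]
  refine Finset.sum_le_sum_of_subset fun z hz => ?_
  simp only [Finite.mem_toFinset, mem_ofPred_eq] at hz ⊢
  exact ⟨hz.1.trans hrt, hz.2⟩

lemma card_le_nMax {f : ℂ → ℂ} (hf : TranscendentalEntire f) {a : ℂ} {r : ℝ} {F : Finset ℂ}
    (hF : ∀ u ∈ F, ‖u‖ ≤ r ∧ f u = a) : F.card ≤ nMax f r := by
  refine le_trans ?_ (le_ciSup (bddAbove_range_nCount hf r) a)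
  rw [nCount_eq_sum hf, Finset.card_eq_sum_ones]
  refine (Finset.sum_le_sum fun u hu => one_le_vanishingOrder hf (hF u hu).2).trans
    (Finset.sum_le_sum_of_subset fun u hu => ?_)
  simpa using hF u hu

lemma abs_det_restrictScalars_smulRight (c : ℂ) :
    |((ContinuousLinearMap.toSpanSingleton ℂ c).restrictScalars ℝ : ℂ →L[ℝ] ℂ).det| =
      ‖c‖ ^ 2 := by
  have h : ((ContinuousLinearMap.toSpanSingleton ℂ c).restrictScalars ℝ : ℂ →L[ℝ] ℂ).det =
      Algebra.norm ℝ c := by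
    rw [Algebra.norm_apply, ContinuousLinearMap.det]
    congr 1
    ext
    simp [mul_comm]
  rw [h, Algebra.norm_complex_apply, Complex.normSq_eq_norm_sq, abs_of_nonneg (by positivity)]

lemma exists_seq_isOpen_injOn_cover {f : ℂ → ℂ} (hf : Differentiable ℂ f) (B : Set ℂ)
    (hB : ∀ z ∈ B, deriv f z ≠ 0) :
    ∃ V : ℕ → Set ℂ, (∀ i, IsOpen (V i)) ∧ (∀ i, InjOn f (V i)) ∧ B ⊆ ⋃ i, V i := by
  have hloc : ∀ z ∈ B, ∃ V : Set ℂ, IsOpen V ∧ z ∈ V ∧ InjOn f V := by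
    intro z hz
    have hstrict : HasStrictDerivAt f (deriv f z) z := (hf.analyticAt z).hasStrictDerivAt
    obtain ⟨V, hV, hVo, hzV⟩ := _root_.mem_nhds_iff.1 (hstrict.eventually_left_inverse (hB z hz))
    exact ⟨V, hVo, hzV, (show LeftInvOn _ f V from fun x hx => hV hx).injOn⟩
  choose! V hVo hzV hinj using hloc
  obtain ⟨t, htB, htc, hcov⟩ := TopologicalSpace.countable_cover_nhdsWithin (f := V) (s := B)
    fun z hz => mem_nhdsWithin_of_mem_nhds ((hVo z hz).mem_nhds (hzV z hz))
  rcases t.eq_empty_or_nonempty with rfl | hne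
  · exact ⟨fun _ => ∅, by simp, by simp, hcov.trans (by simp)⟩
  obtain ⟨e, rfl⟩ := htc.exists_eq_range hne
  refine ⟨fun i => V (e i), fun i => hVo _ (htB ⟨i, rfl⟩), fun i => hinj _ (htB ⟨i, rfl⟩), ?_⟩
  simpa using hcov

/-- Change of variables under a holomorphic map that is at most `N`-to-one on `B`. -/
lemma lintegral_norm_deriv_sq_mul_le {f : ℂ → ℂ} (hf : Differentiable ℂ f) {B S : Set ℂ}
    (hBm : MeasurableSet B) (hSm : MeasurableSet S) (hB : ∀ z ∈ B, deriv f z ≠ 0)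
    (hBS : ∀ z ∈ B, f z ∈ S) {N : ℕ}
    (hN : ∀ (w : ℂ) (F : Finset ℂ), (∀ z ∈ F, z ∈ B ∧ f z = w) → F.card ≤ N)
    {φ : ℂ → ℝ≥0∞} (hφ : Measurable φ) :
    ∫⁻ z in B, ENNReal.ofReal (‖deriv f z‖ ^ 2) * φ (f z) ≤ N * ∫⁻ w in S, φ w := by
  obtain ⟨V, hVo, hinj, hcov⟩ := exists_seq_isOpen_injOn_cover hf B hB
  set E : ℕ → Set ℂ := fun i => B ∩ disjointed V i with hE
  have hEm : ∀ i, MeasurableSet (E i) := fun i =>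
    hBm.inter (MeasurableSet.disjointed (fun j => (hVo j).measurableSet) i)
  have hEinj : ∀ i, InjOn f (E i) := fun i =>
    (hinj i).mono (inter_subset_right.trans (disjointed_subset V i))
  have hEB : B = ⋃ i, E i := by
    rw [hE, ← inter_iUnion, iUnion_disjointed, inter_eq_left.2 hcov]
  have him : ∀ i, MeasurableSet (f '' E i) := fun i =>
    (hEm i).image_of_continuousOn_injOn hf.continuous.continuousOn (hEinj i)
  have hcv : ∀ i, ∫⁻ z in E i, ENNReal.ofReal (‖deriv f z‖ ^ 2) * φ (f z) =
      ∫⁻ w, (f '' E i).indicator φ w := by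
    intro i
    rw [lintegral_indicator (him i),
      lintegral_image_eq_lintegral_abs_det_fderiv_mul volume (hEm i)
        (f' := fun z => (ContinuousLinearMap.toSpanSingleton ℂ (deriv f z)).restrictScalars ℝ)
        (fun z _ => ((hf z).hasDerivAt.hasFDerivAt.restrictScalars ℝ).hasFDerivWithinAt)
        (hEinj i)]
    simp only [abs_det_restrictScalars_smulRight]
  have hpt : ∀ w, ∑' i, (f '' E i).indicator φ w ≤ S.indicator (fun w => N * φ w) w := by
    intro w
    by_cases hw : w ∈ S
    · rw [indicator_of_mem hw, ENNReal.tsum_eq_iSup_sum]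
      refine iSup_le fun I => ?_
      classical
      simp only [indicator_apply]
      rw [← Finset.sum_filter, Finset.sum_const, nsmul_eq_mul]
      gcongr
      have hch : ∀ i ∈ I.filter fun i => w ∈ f '' E i, ∃ z, z ∈ E i ∧ f z = w :=
        fun i hi => (Finset.mem_filter.1 hi).2
      choose! p hp using hch
      rw [← Finset.card_image_of_injOn (f := p)]
      · refine hN w _ fun z hz => ?_
        obtain ⟨i, hi, rfl⟩ := Finset.mem_image.1 hz
        exact ⟨(hp i hi).1.1, (hp i hi).2⟩
      · intro i hi j hj hij
        by_contra hne
        have hd := disjoint_disjointed V hne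
        exact Set.disjoint_left.1 hd (hp i hi).1.2 (hij ▸ (hp j hj).1.2)
    · rw [indicator_of_notMem hw, nonpos_iff_eq_zero, ENNReal.tsum_eq_zero]
      intro i
      refine indicator_of_notMem ?_ _
      rintro ⟨z, hz, rfl⟩
      exact hw (hBS z hz.1)
  calc ∫⁻ z in B, ENNReal.ofReal (‖deriv f z‖ ^ 2) * φ (f z)
      = ∫⁻ z in ⋃ i, E i, ENNReal.ofReal (‖deriv f z‖ ^ 2) * φ (f z) := by rw [← hEB]
    _ ≤ ∑' i, ∫⁻ z in E i, ENNReal.ofReal (‖deriv f z‖ ^ 2) * φ (f z) := lintegral_iUnion_le _ _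
    _ = ∑' i, ∫⁻ w, (f '' E i).indicator φ w := by simp only [hcv]
    _ = ∫⁻ w, ∑' i, (f '' E i).indicator φ w :=
      (lintegral_tsum fun i => (hφ.indicator (him i)).aemeasurable).symm
    _ ≤ ∫⁻ w, S.indicator (fun w => N * φ w) w := lintegral_mono hpt
    _ = N * ∫⁻ w in S, φ w := by
      rw [lintegral_indicator hSm, lintegral_const_mul _ hφ]

lemma measurable_ofReal_norm_sq_inv :
    Measurable fun w : ℂ => ENNReal.ofReal ((‖w‖ ^ 2)⁻¹) := by
  fun_prop

/-- If the squared modulus of the logarithmic derivative of `f` is at least `(c ‖z‖ ^ 2)⁻¹` on `B` and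
`f` is at most `N`-to-one there, then the logarithmic area of `B` is at most `c * N` times that of
`S`. -/
lemma logArea_le_of_inv_norm_sq_le {f : ℂ → ℂ} (hf : Differentiable ℂ f) {B S : Set ℂ}
    (hBm : MeasurableSet B) (hSm : MeasurableSet S) (hB : ∀ z ∈ B, deriv f z ≠ 0)
    (hBS : ∀ z ∈ B, f z ∈ S) {N : ℕ}
    (hN : ∀ (w : ℂ) (F : Finset ℂ), (∀ z ∈ F, z ∈ B ∧ f z = w) → F.card ≤ N)
    {c : ℝ} (hc : 0 ≤ c)
    (hle : ∀ z ∈ B, (‖z‖ ^ 2)⁻¹ ≤ c * (‖deriv f z‖ ^ 2 * (‖f z‖ ^ 2)⁻¹)) :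
    logArea B ≤ ENNReal.ofReal (c * N) * logArea S := by
  have hd : Measurable (deriv f) := measurable_deriv f
  have hfm : Measurable f := hf.continuous.measurable
  calc logArea B
      ≤ ∫⁻ z in B, ENNReal.ofReal c *
          (ENNReal.ofReal (‖deriv f z‖ ^ 2) * ENNReal.ofReal ((‖f z‖ ^ 2)⁻¹)) := by
        refine setLIntegral_mono (by fun_prop) fun z hz => ?_
        rw [← ENNReal.ofReal_mul (by positivity), ← ENNReal.ofReal_mul hc]
        exact ENNReal.ofReal_le_ofReal (hle z hz)
    _ = ENNReal.ofReal c *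
          ∫⁻ z in B, ENNReal.ofReal (‖deriv f z‖ ^ 2) * ENNReal.ofReal ((‖f z‖ ^ 2)⁻¹) :=
        lintegral_const_mul _ (by fun_prop)
    _ ≤ ENNReal.ofReal c * (N * logArea S) := by
        gcongr
        exact lintegral_norm_deriv_sq_mul_le hf hBm hSm hB hBS hN measurable_ofReal_norm_sq_inv
    _ = ENNReal.ofReal (c * N) * logArea S := by
        rw [ENNReal.ofReal_mul hc, ENNReal.ofReal_natCast, mul_assoc]

lemma hasSum_two_rpow {ε : ℝ} (hε : 0 < ε) (K : ℕ) :
    HasSum (fun j : ℕ => (2 : ℝ) ^ (1 - 2 * ε * ((K + j : ℕ) : ℝ)))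
      ((2 : ℝ) ^ ((1 : ℝ) - 2 * ε * K) / (1 - (2 : ℝ) ^ (-(2 * ε)))) := by
  have h1 : (2 : ℝ) ^ (-(2 * ε)) < 1 := Real.rpow_lt_one_of_one_lt_of_neg one_lt_two (by linarith)
  have h := (hasSum_geometric_of_lt_one (by positivity) h1).mul_left
    ((2 : ℝ) ^ ((1 : ℝ) - 2 * ε * K))
  rw [div_eq_mul_inv]
  refine h.congr_fun fun j => ?_
  rw [← Real.rpow_natCast, ← Real.rpow_mul zero_le_two, ← Real.rpow_add zero_lt_two]
  congr 1
  push_cast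
  ring

theorem logarea_preimage_contraction
    (f : ℂ → ℂ) (hf : TranscendentalEntire f) (ε : ℝ) (hε : 0 < ε)
    (R : ℝ) (hR : 1 < R) (K : ℕ) (hK : 2 ^ K ≤ nMax f R)
    (S : Set ℂ) (hS : MeasurableSet S) (hSfin : logArea S < ⊤) :
    logArea (f ⁻¹' S ∩
        {z : ℂ | f z ≠ 0 ∧ (nMax f ‖z‖ : ℝ) ^ ((1 : ℝ) / 2 + ε) ≤ ‖z * deriv f z / f z‖} ∩
        {z : ℂ | R ≤ ‖z‖}) ≤
      ENNReal.ofReal ((2 : ℝ) ^ ((1 : ℝ) - 2 * ε * K) / (1 - (2 : ℝ) ^ (-(2 * ε)))) *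
        logArea S := by
  obtain ⟨hd, -⟩ := id hf
  set T : Set ℂ := f ⁻¹' S ∩
        {z : ℂ | f z ≠ 0 ∧ (nMax f ‖z‖ : ℝ) ^ ((1 : ℝ) / 2 + ε) ≤ ‖z * deriv f z / f z‖} ∩
        {z : ℂ | R ≤ ‖z‖} with hT
  have hfm : Measurable f := hd.continuous.measurable
  have hdm : Measurable (deriv f) := measurable_deriv f
  have hnm : Measurable fun z : ℂ => nMax f ‖z‖ := (nMax_monotone hf).measurable.comp measurable_norm
  have hnm' : Measurable fun z : ℂ => (nMax f ‖z‖ : ℝ) := measurable_from_nat.comp hnm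
  have hTm : MeasurableSet T := by
    have hX : MeasurableSet {z : ℂ |
        (nMax f ‖z‖ : ℝ) ^ ((1 : ℝ) / 2 + ε) ≤ ‖z * deriv f z / f z‖} :=
      measurableSet_le (hnm'.pow_const _) (by fun_prop)
    exact ((hfm hS).inter ((hfm (measurableSet_singleton 0).compl).inter hX)).inter
      (measurableSet_le measurable_const measurable_norm)
  set B : ℕ → Set ℂ := fun j => T ∩
    {z : ℂ | 2 ^ (K + j) ≤ nMax f ‖z‖ ∧ nMax f ‖z‖ < 2 ^ (K + j + 1)} with hBdef
  have hTB : T ⊆ ⋃ j, B j := by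
    intro z hz
    have hn : 2 ^ K ≤ nMax f ‖z‖ := hK.trans (nMax_monotone hf hz.2)
    have hn0 : nMax f ‖z‖ ≠ 0 := (lt_of_lt_of_le (by positivity) hn).ne'
    have hKl : K ≤ Nat.log 2 (nMax f ‖z‖) := Nat.le_log_of_pow_le one_lt_two hn
    obtain ⟨j, hj⟩ := Nat.exists_eq_add_of_le hKl
    refine mem_iUnion.2 ⟨j, hz, ?_, ?_⟩
    · rw [← hj]
      exact Nat.pow_log_le_self 2 hn0
    · rw [← hj]
      exact Nat.lt_pow_succ_log_self one_lt_two _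
  have hBle : ∀ j, logArea (B j) ≤
      ENNReal.ofReal ((2 : ℝ) ^ (1 - 2 * ε * ((K + j : ℕ) : ℝ))) * logArea S := by
    intro j
    set k := K + j with hk
    have hlow : ∀ z ∈ B j, (2 : ℝ) ^ ((k : ℝ) * (1 / 2 + ε)) * ‖f z‖ ≤ ‖z‖ * ‖deriv f z‖ := by
      rintro z ⟨⟨⟨-, hz0, hz⟩, -⟩, hzn, -⟩
      rw [norm_div, norm_mul, le_div_iff₀ (norm_pos_iff.2 hz0)] at hz
      refine le_trans ?_ hz
      rw [Real.rpow_mul zero_le_two, Real.rpow_natCast]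
      gcongr
      exact_mod_cast hzn
    have hc : (2 : ℝ) ^ (1 - 2 * ε * (k : ℝ)) =
        (((2 : ℝ) ^ ((k : ℝ) * (1 / 2 + ε))) ^ 2)⁻¹ * ((2 ^ (k + 1) : ℕ) : ℝ) := by
      push_cast
      rw [← Real.rpow_natCast, ← Real.rpow_natCast, ← Real.rpow_mul zero_le_two,
        ← Real.rpow_neg zero_le_two, ← Real.rpow_add zero_lt_two]
      congr 1
      push_cast
      ring
    rw [hc]
    refine logArea_le_of_inv_norm_sq_le hd ?_ hS (fun z hz h0 => ?_) (fun z hz => hz.1.1.1)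
      (fun w F hF => ?_) (by positivity) (fun z hz => ?_)
    · exact hTm.inter ((measurableSet_le measurable_const hnm).inter
        (measurableSet_lt hnm measurable_const))
    · have h1 := hlow z hz
      have h2 : 0 < ‖f z‖ := norm_pos_iff.2 hz.1.1.2.1
      rw [h0, norm_zero, mul_zero] at h1
      exact h1.not_gt (by positivity)
    · rcases F.eq_empty_or_nonempty with rfl | hne
      · simp
      obtain ⟨z, hz, hmax⟩ := F.exists_max_image (fun z => ‖z‖) hne
      exact (card_le_nMax hf fun u hu => ⟨hmax u hu, (hF u hu).2⟩).trans (hF z hz).1.2.2.le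
    · have h1 := hlow z hz
      have h2 : 0 < ‖f z‖ := norm_pos_iff.2 hz.1.1.2.1
      have h3 : 0 < ‖z‖ := lt_of_lt_of_le (by linarith) hz.1.2
      set q : ℝ := (2 : ℝ) ^ ((k : ℝ) * (1 / 2 + ε)) with hq
      have hq0 : 0 < q := by positivity
      have h4 : (q * ‖f z‖) ^ 2 ≤ (‖z‖ * ‖deriv f z‖) ^ 2 := by gcongr
      have h5 : (q ^ 2)⁻¹ * (‖deriv f z‖ ^ 2 * (‖f z‖ ^ 2)⁻¹) =
          ‖deriv f z‖ ^ 2 / (q * ‖f z‖) ^ 2 := by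
        rw [mul_pow]
        field_simp
      rw [h5, inv_eq_one_div, div_le_div_iff₀ (by positivity) (by positivity)]
      rw [mul_pow ‖z‖] at h4
      linarith
  have hsum := hasSum_two_rpow hε K
  calc logArea T ≤ logArea (⋃ j, B j) := lintegral_mono_set hTB
    _ ≤ ∑' j, logArea (B j) := lintegral_iUnion_le _ _
    _ ≤ ∑' j, ENNReal.ofReal ((2 : ℝ) ^ (1 - 2 * ε * ((K + j : ℕ) : ℝ))) * logArea S :=
      ENNReal.tsum_le_tsum hBle
    _ = _ := by
      rw [ENNReal.tsum_mul_right, ← ENNReal.ofReal_tsum_of_nonneg (fun j => by positivity)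
        hsum.summable, hsum.tsum_eq]
end

section
/- Let p be a polynomial of degree d ≥ 2. Then there exist R > 0 and c₁ > 0 such that for every z ∈ ℂ with |z| > R and every n ∈ ℕ, |pⁿ(z)| > exp(c₁ dⁿ), where pⁿ denotes the n-th iterate of p. -/
open Filter Topology in
/-- A complex polynomial dominates a positive multiple of its leading power near infinity. -/
theorem Polynomial.exists_mul_norm_pow_le_norm_eval {p : Polynomial ℂ} (hp : p ≠ 0) :
    ∃ a : ℝ, 0 < a ∧ a ≤ 1 ∧ ∃ r : ℝ, 0 < r ∧
      ∀ z : ℂ, r < ‖z‖ → a * ‖z‖ ^ p.natDegree ≤ ‖p.eval z‖ := by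
  have hlead : 0 < ‖p.leadingCoeff‖ := norm_pos_iff.mpr (leadingCoeff_ne_zero.mpr hp)
  have hlim : Tendsto (fun w => ‖p.reverse.eval w‖) (𝓝 0) (𝓝 ‖p.leadingCoeff‖) := by
    have h := p.reverse.continuous.norm.tendsto 0
    rwa [← coeff_zero_eq_eval_zero, coeff_zero_reverse] at h
  obtain ⟨ε, hε, hball⟩ := Metric.eventually_nhds_iff.mp
    (hlim.eventually (lt_mem_nhds (half_lt_self hlead)))
  refine ⟨min 1 (‖p.leadingCoeff‖ / 2), by positivity, min_le_left _ _, ε⁻¹, by positivity,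
    fun z hz => ?_⟩
  have hz0 : 0 < ‖z‖ := (inv_pos.mpr hε).trans hz
  have hrev : p.reverse.eval z⁻¹ * z ^ p.natDegree = p.eval z := by
    let := invertibleOfNonzero (norm_pos_iff.mp hz0)
    simpa [eval₂_eq_eval_map] using eval₂_reverse_mul_pow (RingHom.id ℂ) z p
  rw [← hrev, norm_mul, norm_pow]
  gcongr
  refine (min_le_right _ _).trans (hball ?_).le
  rw [dist_zero_right, norm_inv]
  exact inv_lt_of_inv_lt₀ hε hz

theorem polynomial_iterate_growth (p : Polynomial ℂ) (hd : 2 ≤ p.natDegree) :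
    ∃ R : ℝ, 0 < R ∧ ∃ c₁ : ℝ, 0 < c₁ ∧ ∀ z : ℂ, R < ‖z‖ → ∀ n : ℕ,
      Real.exp (c₁ * (p.natDegree : ℝ) ^ n) < ‖(fun w => p.eval w)^[n] z‖ := by
  have hp : p ≠ 0 := by
    rintro rfl
    simp at hd
  obtain ⟨a, ha, ha1, r, hr, hgrow⟩ := Polynomial.exists_mul_norm_pow_le_norm_eval hp
  set c := max 1 (Real.log (a * r))
  have hc : 0 < c := by positivity
  have hrc : a * r ≤ Real.exp c := (Real.log_le_iff_le_exp (by positivity)).mp (le_max_right _ _)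
  have hd1 : (1 : ℝ) ≤ p.natDegree := by exact_mod_cast one_le_two.trans hd
  refine ⟨Real.exp c / a, by positivity, c, hc, fun z hz n => ?_⟩
  suffices h : Real.exp (c * (p.natDegree : ℝ) ^ n) < a * ‖(fun w => p.eval w)^[n] z‖ from
    h.trans_le (mul_le_of_le_one_left (norm_nonneg _) ha1)
  induction n with
  | zero => simpa [mul_comm] using (div_lt_iff₀ ha).mp hz
  | succ n ih =>
    rw [Function.iterate_succ_apply']
    set w := (fun w => p.eval w)^[n] z
    have hw : r < ‖w‖ := by
      refine lt_of_mul_lt_mul_left ((hrc.trans ?_).trans_lt ih) ha.le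
      exact Real.exp_le_exp.mpr (le_mul_of_one_le_right hc.le (one_le_pow₀ hd1))
    calc Real.exp (c * (p.natDegree : ℝ) ^ (n + 1))
        = Real.exp (c * (p.natDegree : ℝ) ^ n) ^ p.natDegree := by
          rw [← Real.exp_nat_mul]
          ring_nf
      _ < (a * ‖w‖) ^ p.natDegree := pow_lt_pow_left₀ ih (Real.exp_pos _).le (by lia)
      _ = a ^ p.natDegree * ‖w‖ ^ p.natDegree := mul_pow _ _ _
      _ ≤ a ^ 2 * ‖w‖ ^ p.natDegree := by
          gcongr ?_ * _
          exact pow_le_pow_of_le_one ha.le ha1 hd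
      _ = a * (a * ‖w‖ ^ p.natDegree) := by ring
      _ ≤ a * ‖p.eval w‖ := by gcongr; exact hgrow w hw
end

section
/- Let p be a polynomial of degree d ≥ 2, let λ ∈ ℂ with |λ| > 1, and let f be a transcendental entire function satisfying f(λz) = p(f(z)) for all z ∈ ℂ. Then the order of f equals log d / log |λ|. -/
open MeasureTheory Filter Metric Set Topology ENNReal

/-- The points of modulus `r` form a compact set. -/
theorem isCompact_norm_eq (r : ℝ) : IsCompact {z : ℂ | ‖z‖ = r} := by
  have h : {z : ℂ | ‖z‖ = r} = sphere 0 r := by ext z; simp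
  exact h ▸ isCompact_sphere 0 r

theorem norm_le_maxMod {f : ℂ → ℂ} (hf : Continuous f) (z : ℂ) : ‖f z‖ ≤ maxMod f ‖z‖ :=
  le_csSup ((isCompact_norm_eq ‖z‖).image hf.norm).bddAbove ⟨z, rfl, rfl⟩

theorem exists_norm_eq_maxMod {f : ℂ → ℂ} (hf : Continuous f) {r : ℝ} (hr : 0 ≤ r) :
    ∃ z : ℂ, ‖z‖ = r ∧ ‖f z‖ = maxMod f r := by
  obtain ⟨z, hz, h⟩ := (isCompact_norm_eq r).exists_sSup_image_eq
    ⟨(r : ℂ), by simp [abs_of_nonneg hr]⟩ hf.norm.continuousOn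
  exact ⟨z, hz, h.symm⟩

theorem maxMod_mono {f : ℂ → ℂ} (hf : Differentiable ℂ f) {r s : ℝ} (hr : 0 ≤ r) (hrs : r ≤ s) :
    maxMod f r ≤ maxMod f s := by
  obtain ⟨z, hz, h⟩ := exists_norm_eq_maxMod hf.continuous hr
  rcases hrs.eq_or_lt with rfl | hlt
  · rfl
  rw [← h]
  refine Complex.norm_le_of_forall_mem_frontier_norm_le (U := ball 0 s) isBounded_ball
    hf.diffContOnCl (fun w hw => ?_) (subset_closure (by simpa [hz] using hlt))
  have hw' : ‖w‖ = s := by simpa using frontier_ball_subset_sphere hw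
  exact hw' ▸ norm_le_maxMod hf.continuous w

theorem TranscendentalEntire.exists_le_maxMod {f : ℂ → ℂ} (hf : TranscendentalEntire f) (K : ℝ) :
    ∃ r : ℝ, 1 ≤ r ∧ K ≤ maxMod f r := by
  by_contra! h
  have hb : Bornology.IsBounded (range f) := by
    refine isBounded_iff_forall_norm_le.2 ⟨K, ?_⟩
    rintro _ ⟨z, rfl⟩
    exact ((norm_le_maxMod hf.1.continuous z).trans
      (maxMod_mono hf.1 (norm_nonneg z) (le_max_left _ 1))).trans (h _ (le_max_right _ _)).le
  obtain ⟨c, hc⟩ := hf.1.exists_const_forall_eq_of_bounded hb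
  exact hf.2 ⟨Polynomial.C c, fun z => by simp [hc z]⟩

theorem Polynomial.norm_eval_le_sum_mul_pow (p : Polynomial ℂ) {w : ℂ} {m : ℝ} (hm : 1 ≤ m)
    (hw : ‖w‖ ≤ m) :
    ‖p.eval w‖ ≤ (∑ i ∈ Finset.range (p.natDegree + 1), ‖p.coeff i‖) * m ^ p.natDegree := by
  rw [Polynomial.eval_eq_sum_range, Finset.sum_mul]
  refine norm_sum_le_of_le _ fun i hi => ?_
  rw [norm_mul, norm_pow]
  gcongr
  exact (pow_le_pow_left₀ (norm_nonneg w) hw i).trans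
    (pow_le_pow_right₀ hm (Nat.lt_succ_iff.1 (Finset.mem_range.1 hi)))

theorem Polynomial.exists_mul_pow_le_norm_eval {p : Polynomial ℂ} (hp : p ≠ 0) :
    ∃ c : ℝ, 0 < c ∧ ∃ K : ℝ, ∀ w : ℂ, K ≤ ‖w‖ → c * ‖w‖ ^ p.natDegree ≤ ‖p.eval w‖ := by
  have ha : 0 < ‖p.leadingCoeff‖ := by simpa using hp
  have h0 : Tendsto (fun x : ℂ => ‖p.reverse.eval x‖) (𝓝 0) (𝓝 ‖p.leadingCoeff‖) := by
    have := (p.reverse.continuous.norm).tendsto 0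
    rwa [← Polynomial.coeff_zero_eq_eval_zero, Polynomial.coeff_zero_reverse] at this
  obtain ⟨δ, hδ, h⟩ := Metric.eventually_nhds_iff.1 (h0.eventually_const_lt (half_lt_self ha))
  refine ⟨‖p.leadingCoeff‖ / 2, by positivity, δ⁻¹ + 1, fun w hw => ?_⟩
  have hδ' : 0 < δ⁻¹ := inv_pos.2 hδ
  have hw0 : 0 < ‖w‖ := by linarith
  have hw0' : w ≠ 0 := norm_pos_iff.1 hw0
  have h1 : ‖p.leadingCoeff‖ / 2 < ‖p.reverse.eval w⁻¹‖ := by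
    refine h ?_
    rw [dist_zero_right, norm_inv]
    exact inv_lt_of_inv_lt₀ hδ (by linarith)
  have h2 : p.reverse.eval w⁻¹ * w ^ p.natDegree = p.eval w := by
    have : Invertible w := invertibleOfNonzero hw0'
    simpa [Polynomial.eval₂_eq_eval_map] using
      Polynomial.eval₂_reverse_mul_pow (RingHom.id ℂ) w p
  rw [← h2, norm_mul, norm_pow]
  gcongr

/-- If `f (λ z) = p (f z)`, then `log M(|λ| r) = d log M(r) + O(1)`. -/
theorem exists_abs_log_maxMod_sub_le {p : Polynomial ℂ} (hp : p ≠ 0) {lam : ℂ} (hlam : lam ≠ 0)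
    {f : ℂ → ℂ} (hf : Continuous f) (hfe : ∀ z : ℂ, f (lam * z) = p.eval (f z)) :
    ∃ B : ℝ, ∃ K : ℝ, ∀ r : ℝ, 0 ≤ r → K ≤ maxMod f r →
      |Real.log (maxMod f (‖lam‖ * r)) - p.natDegree * Real.log (maxMod f r)| ≤ B := by
  obtain ⟨c, hc, K, hK⟩ := Polynomial.exists_mul_pow_le_norm_eval hp
  set C := ∑ i ∈ Finset.range (p.natDegree + 1), ‖p.coeff i‖
  refine ⟨max |Real.log C| |Real.log c|, max K 1, fun r hr hM => ?_⟩
  have hM1 : 1 ≤ maxMod f r := (le_max_right _ _).trans hM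
  have hpow : 0 < maxMod f r ^ p.natDegree := by positivity
  have hlow : c * maxMod f r ^ p.natDegree ≤ maxMod f (‖lam‖ * r) := by
    obtain ⟨z, hz, h⟩ := exists_norm_eq_maxMod hf hr
    have h1 := hK (f z) (h ▸ (le_max_left _ _).trans hM)
    have h2 := norm_le_maxMod hf (lam * z)
    rw [norm_mul, hz, hfe] at h2
    exact h ▸ h1.trans h2
  have hup : maxMod f (‖lam‖ * r) ≤ C * maxMod f r ^ p.natDegree := by
    obtain ⟨w, hw, h⟩ := exists_norm_eq_maxMod hf (r := ‖lam‖ * r) (by positivity)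
    have hz : ‖w / lam‖ = r := by
      rw [norm_div, hw, mul_div_cancel_left₀ _ (norm_ne_zero_iff.2 hlam)]
    rw [← h, ← mul_div_cancel₀ w hlam, hfe]
    exact p.norm_eval_le_sum_mul_pow hM1 (hz ▸ norm_le_maxMod hf _)
  have hpos : 0 < maxMod f (‖lam‖ * r) := (mul_pos hc hpow).trans_le hlow
  have hCpos : 0 < C := pos_of_mul_pos_left (hpos.trans_le hup) hpow.le
  have h1 := Real.log_le_log (mul_pos hc hpow) hlow
  have h2 := Real.log_le_log hpos hup
  rw [Real.log_mul hc.ne' hpow.ne', Real.log_pow] at h1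
  rw [Real.log_mul hCpos.ne' hpow.ne', Real.log_pow] at h2
  rw [abs_le]
  constructor
  · linarith [neg_abs_le (Real.log c), le_max_right |Real.log C| |Real.log c|]
  · linarith [le_abs_self (Real.log C), le_max_left |Real.log C| |Real.log c|]

/-- A monotone function with `L (R r) = d L(r) + O(1)` that is large somewhere satisfies
`log (L r) / log r → log d / log R`. -/
theorem tendsto_log_div_log_of_abs_sub_le {L : ℝ → ℝ} {R d B r₀ : ℝ} (hR : 1 < R) (hd : 2 ≤ d)
    (hr₀ : 0 < r₀) (hL : MonotoneOn L (Ici r₀)) (h₀ : B + 1 ≤ L r₀)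
    (h : ∀ r, r₀ ≤ r → |L (R * r) - d * L r| ≤ B) :
    Tendsto (fun r => Real.log (L r) / Real.log r) atTop (𝓝 (Real.log d / Real.log R)) := by
  have hlR : 0 < Real.log R := Real.log_pos hR
  have hld : 0 < Real.log d := Real.log_pos (by linarith)
  have hB : 0 ≤ B := (abs_nonneg _).trans (h r₀ le_rfl)
  have hge (n : ℕ) : r₀ ≤ R ^ n * r₀ := le_mul_of_one_le_left hr₀.le (one_le_pow₀ hR.le)
  have hiter (n : ℕ) : d ^ n ≤ L (R ^ n * r₀) - B ∧
      L (R ^ n * r₀) + B ≤ d ^ n * (L r₀ + B) := by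
    induction n with
    | zero => simpa using by linarith
    | succ n ih =>
      have := abs_le.1 (h _ (hge n))
      rw [← mul_assoc, ← pow_succ'] at this
      constructor
      · rw [pow_succ']
        nlinarith [mul_le_mul_of_nonneg_left ih.1 (by linarith : 0 ≤ d)]
      · rw [pow_succ' d]
        nlinarith [mul_le_mul_of_nonneg_left ih.2 (by linarith : 0 ≤ d)]
  set A := L r₀ + B with hA
  have hA0 : 0 < A := by linarith
  set E := Real.log d + |Real.log A| + Real.log d * |Real.log r₀| / Real.log R with hE
  have hbound (r : ℝ) (hr : r₀ ≤ r) :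
      |Real.log (L r) - Real.log d / Real.log R * Real.log r| ≤ E := by
    have hr0 : 0 < r := hr₀.trans_le hr
    obtain ⟨n, hn1, hn2⟩ := exists_nat_pow_near ((one_le_div hr₀).2 hr) hR
    rw [le_div_iff₀ hr₀] at hn1
    rw [div_lt_iff₀ hr₀] at hn2
    have hlow : d ^ n ≤ L r := by linarith [(hiter n).1, hL (hge n) hr hn1]
    have hup : L r ≤ d ^ (n + 1) * A := by
      linarith [(hiter (n + 1)).2, hL hr (hge (n + 1)) hn2.le]
    have hdn : 0 < d ^ n := by positivity
    have e1 := Real.log_le_log hdn hlow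
    have e2 := Real.log_le_log (hdn.trans_le hlow) hup
    have e3 := Real.log_le_log (by positivity) hn1
    have e4 := Real.log_le_log hr0 hn2.le
    rw [Real.log_pow] at e1
    rw [Real.log_mul (by positivity) hA0.ne', Real.log_pow] at e2
    rw [Real.log_mul (by positivity) hr₀.ne', Real.log_pow] at e3 e4
    have f3 := mul_le_mul_of_nonneg_left e3 (div_pos hld hlR).le
    have f4 := mul_le_mul_of_nonneg_left e4 (div_pos hld hlR).le
    have k (x : ℝ) : Real.log d / Real.log R * (x * Real.log R + Real.log r₀) =
      x * Real.log d + Real.log d / Real.log R * Real.log r₀ := by field_simp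
    rw [k] at f3 f4
    push_cast at e2 f4
    have g1 := mul_le_mul_of_nonneg_left (le_abs_self (Real.log r₀)) (div_pos hld hlR).le
    have g2 := mul_le_mul_of_nonneg_left (neg_abs_le (Real.log r₀)) (div_pos hld hlR).le
    have g3 : Real.log d * |Real.log r₀| / Real.log R =
      Real.log d / Real.log R * |Real.log r₀| := by ring
    rw [abs_le]
    constructor <;> linarith [le_abs_self (Real.log A), abs_nonneg (Real.log A)]
  rw [tendsto_iff_norm_sub_tendsto_zero]
  refine squeeze_zero' (Eventually.of_forall fun _ => norm_nonneg _) ?_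
    (Real.tendsto_log_atTop.const_div_atTop E)
  filter_upwards [eventually_ge_atTop r₀, eventually_gt_atTop 1] with r hr hr1
  have hlr : 0 < Real.log r := Real.log_pos hr1
  rw [Real.norm_eq_abs, le_div_iff₀ hlr, ← abs_of_pos hlr, ← abs_mul, abs_of_pos hlr, sub_mul,
    div_mul_cancel₀ _ hlr.ne']
  exact hbound r hr

theorem poincare_function_order
    (p : Polynomial ℂ) (hd : 2 ≤ p.natDegree) (lam : ℂ) (hlam : 1 < ‖lam‖)
    (f : ℂ → ℂ) (hf : TranscendentalEntire f)
    (hfe : ∀ z : ℂ, f (lam * z) = p.eval (f z)) :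
    entireOrder f = ((Real.log (p.natDegree : ℝ) / Real.log ‖lam‖ : ℝ) : EReal) := by
  have hp : p ≠ 0 := by rintro rfl; simp at hd
  have hlam0 : lam ≠ 0 := by rintro rfl; norm_num at hlam
  obtain ⟨B, K, hB⟩ := exists_abs_log_maxMod_sub_le hp hlam0 hf.1.continuous hfe
  obtain ⟨r₀, hr₀, hM⟩ := hf.exists_le_maxMod (max K (Real.exp (B + 1)))
  have hr₀' : 0 < r₀ := by linarith
  have hexp : Real.exp (B + 1) ≤ maxMod f r₀ := (le_max_right _ _).trans hM
  have hmono (r s : ℝ) (hr : r₀ ≤ r) (hrs : r ≤ s) : maxMod f r ≤ maxMod f s :=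
    maxMod_mono hf.1 (hr₀'.le.trans hr) hrs
  have hpos (r : ℝ) (hr : r₀ ≤ r) : 0 < maxMod f r :=
    (Real.exp_pos _).trans_le (hexp.trans (hmono r₀ r le_rfl hr))
  have key := tendsto_log_div_log_of_abs_sub_le (L := fun r => Real.log (maxMod f r)) hlam
    (d := p.natDegree) (by exact_mod_cast hd) hr₀'
    (fun r hr s _ hrs => Real.log_le_log (hpos r hr) (hmono r s hr hrs))
    ((Real.le_log_iff_exp_le (hpos r₀ le_rfl)).2 hexp)
    (fun r hr => hB r (hr₀'.le.trans hr)
      ((le_max_left _ _).trans (hM.trans (hmono r₀ r le_rfl hr))))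
  exact ((continuous_coe_real_ereal.tendsto _).comp key).limsup_eq
end
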